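/- Let 𝔞 ⊇ 𝔟 be arbitrary ideals of S. Then for almost all α, height(𝔞_α/𝔟_α) = height(𝔞/𝔟), i.e. the height of the image of 𝔞_α in S_α/𝔟_α equals the height of the image of 𝔞 in S/𝔟. -/

import Mathlib

set_option maxHeartbeats 1000000
set_option synthInstance.maxHeartbeats 1000000

noncomputable section

namespace Spl

open MvPolynomial

/-- "Q(α) holds for almost all α ∈ K^m", i.e. away from a proper algebraic
subvariety of `K^m`. -/
def AlmostAll (K : Type) [Field K] (m : ℕ) (Q : (Fin m → K) → Prop) : Prop :=
  ∃ c : MvPolynomial (Fin m) K, c ≠ 0 ∧ ∀ α : Fin m → K, MvPolynomial.eval α c ≠ 0 → Q α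

variable (k K : Type) [Field k] [Field K] [Algebra k K]

/-- the field k(u) of rational functions in u = (u_1, ..., u_m) -/
abbrev kU (m : ℕ) := FractionRing (MvPolynomial (Fin m) k)

/-- the polynomial ring R = k(u)[X_1, ..., X_n] -/
abbrev Rg (m n : ℕ) := MvPolynomial (Fin n) (kU k m)

/-- the subfield k(α) ⊆ K generated by α = (α_1, ..., α_m) over k -/
abbrev kA {m : ℕ} (α : Fin m → K) := IntermediateField.adjoin k (Set.range α)

/-- the polynomial ring R_α = k(α)[X_1, ..., X_n] -/
abbrev Ra {m : ℕ} (n : ℕ) (α : Fin m → K) := MvPolynomial (Fin n) (kA k K α)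

/-- evaluation u ↦ α, from k[u] to k(α) -/
def evalα {m : ℕ} (α : Fin m → K) : MvPolynomial (Fin m) k →+* kA k K α :=
  (MvPolynomial.aeval fun i =>
    (⟨α i, IntermediateField.subset_adjoin k (Set.range α) ⟨i, rfl⟩⟩ : kA k K α)).toRingHom

/-- the inclusion k[u][X] → R = k(u)[X] -/
def toR (m n : ℕ) : MvPolynomial (Fin n) (MvPolynomial (Fin m) k) →+* Rg k m n :=
  MvPolynomial.map (algebraMap (MvPolynomial (Fin m) k) (kU k m))

/-- substitution u ↦ α, from k[u][X] to R_α = k(α)[X] -/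
def toRa {m : ℕ} (n : ℕ) (α : Fin m → K) :
    MvPolynomial (Fin n) (MvPolynomial (Fin m) k) →+* Ra k K n α :=
  MvPolynomial.map (evalα k K α)

/-- Krull's specialization I_α = { f(α,X) | f(u,X) ∈ I ∩ k[u,X] } of an ideal I ⊆ R
(as an ideal of R_α, i.e. the ideal spanned by the specialized elements). -/
def idealSpec {m : ℕ} (n : ℕ) (α : Fin m → K) (I : Ideal (Rg k m n)) :
    Ideal (Ra k K n α) :=
  Ideal.span (toRa k K n α '' { f | toR k m n f ∈ I })

/-- `ElemSpec k K n α f fα` : fα is the specialization of f ∈ R at α, i.e. writing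
f = p(u,X)/q(u) with q(α) ≠ 0 one has fα = p(α,X)/q(α). -/
def ElemSpec {m : ℕ} (n : ℕ) (α : Fin m → K) (f : Rg k m n) (fα : Ra k K n α) : Prop :=
  ∃ (p : MvPolynomial (Fin n) (MvPolynomial (Fin m) k)) (q : MvPolynomial (Fin m) k),
    evalα k K α q ≠ 0 ∧
    MvPolynomial.C (algebraMap (MvPolynomial (Fin m) k) (kU k m) q) * f = toR k m n p ∧
    MvPolynomial.C (evalα k K α q) * fα = toRa k K n α p

variable {k K}

/-- `LocElemSpec P ℘ a aα` : aα ∈ S_α = (R_α)_℘ is the specialization of a ∈ S = R_P,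
i.e. writing a = f/g with f, g ∈ R, g ∉ P, one has g_α ∉ ℘ and aα = f_α/g_α. -/
def LocElemSpec {m n : ℕ} {α : Fin m → K} (P : Ideal (Rg k m n)) [P.IsPrime]
    (℘ : Ideal (Ra k K n α)) [℘.IsPrime]
    {S : Type} [CommRing S] [Algebra (Rg k m n) S] [IsLocalization.AtPrime S P]
    {Sα : Type} [CommRing Sα] [Algebra (Ra k K n α) Sα] [IsLocalization.AtPrime Sα ℘]
    (a : S) (aα : Sα) : Prop :=
  ∃ (f g : Rg k m n) (fα gα : Ra k K n α) (hg : g ∈ P.primeCompl)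
    (hgα : gα ∈ ℘.primeCompl),
    ElemSpec k K n α f fα ∧ ElemSpec k K n α g gα ∧
    a = IsLocalization.mk' S f ⟨g, hg⟩ ∧
    aα = IsLocalization.mk' Sα fα ⟨gα, hgα⟩

/-- entrywise specialization of matrices, relative to an element-specialization
relation `E`. -/
def MatSpec {S T : Type} (E : S → T → Prop) {r s : ℕ}
    (A : Matrix (Fin r) (Fin s) S) (B : Matrix (Fin r) (Fin s) T) : Prop :=
  ∀ i j, E (A i j) (B i j)

/-- the cokernel of the linear map attached to a matrix A, i.e. the module
presented by A. -/
abbrev MatCoker {S : Type} [CommRing S] {r s : ℕ} (A : Matrix (Fin r) (Fin s) S) :=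
  (Fin r → S) ⧸ LinearMap.range A.mulVecLin

/-- a finite free presentation F_1 → F_0 → L → 0 of the module L, where the map
F_1 → F_0 is given by the matrix A and the map F_0 → L is π. -/
structure Present (S : Type) [CommRing S] (r s : ℕ) (L : Type) [AddCommGroup L]
    [Module S L] where
  A : Matrix (Fin r) (Fin s) S
  π : (Fin r → S) →ₗ[S] L
  surj : Function.Surjective π
  ker_eq : LinearMap.ker π = LinearMap.range A.mulVecLin

theorem comm_le {S : Type} [CommRing S] {r s r' s' : ℕ} {B : Matrix (Fin r) (Fin s) S}
    {C : Matrix (Fin r') (Fin s') S} {W : Matrix (Fin r') (Fin r) S}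
    {W1 : Matrix (Fin s') (Fin s) S} (h : W * B = C * W1) :
    LinearMap.range B.mulVecLin ≤ (LinearMap.range C.mulVecLin).comap W.mulVecLin := by
  rintro x ⟨y, rfl⟩
  exact ⟨W1.mulVecLin y, by
    simp only [Matrix.mulVecLin_apply, Matrix.mulVec_mulVec, h]⟩

/-- the map between the modules presented by B and C induced by the matrix W
(a specialization of a lift of a map between the presented modules). -/
def cokerMap {S : Type} [CommRing S] {r s r' s' : ℕ} {B : Matrix (Fin r) (Fin s) S}
    {C : Matrix (Fin r') (Fin s') S} (W : Matrix (Fin r') (Fin r) S)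
    (h : LinearMap.range B.mulVecLin ≤ (LinearMap.range C.mulVecLin).comap W.mulVecLin) :
    MatCoker B →ₗ[S] MatCoker C :=
  Submodule.mapQ _ _ W.mulVecLin h

/-- a lift of a homomorphism v : L → M to given finite free presentations of L and M:
a commutative diagram whose vertical maps are given by the matrices V1, V0. -/
structure MapLift {S : Type} [CommRing S] {rL sL rM sM : ℕ} {L M : Type}
    [AddCommGroup L] [Module S L] [AddCommGroup M] [Module S M]
    (pL : Present S rL sL L) (pM : Present S rM sM M) (v : L →ₗ[S] M) where
  V0 : Matrix (Fin rM) (Fin rL) S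
  V1 : Matrix (Fin sM) (Fin sL) S
  comm0 : pM.π ∘ₗ V0.mulVecLin = v ∘ₗ pL.π
  comm1 : V0 * pL.A = pM.A * V1

/-- Krull dimension of a module, dim L = dim S/Ann L. -/
def moduleDim (S : Type) [CommRing S] (L : Type) [AddCommGroup L] [Module S L] :
    WithBot ℕ∞ :=
  ringKrullDim (S ⧸ Module.annihilator S L)

/-- height of an ideal: the infimum of dim S_p over the primes p ⊇ I. -/
def idealHeight {S : Type} [CommRing S] (I : Ideal S) : WithBot ℕ∞ :=
  sInf { d | ∃ (p : Ideal S) (hp : p.IsPrime), I ≤ p ∧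
    d = ringKrullDim (Localization (@Ideal.primeCompl _ _ p hp)) }

/-- length of a module: the longest chain of submodules. -/
def moduleLength (S : Type) [CommRing S] (L : Type) [AddCommGroup L] [Module S L] :
    WithBot ℕ∞ :=
  Order.krullDim (Submodule S L)

/-- grade(𝔞, L) ≥ t : there is an L-regular sequence of length t in 𝔞. -/
def GradeGE {S : Type} [CommRing S] (𝔞 : Ideal S) (L : Type) [AddCommGroup L]
    [Module S L] (t : ℕ) : Prop :=
  ∃ rs : List S, rs.length = t ∧ (∀ x ∈ rs, x ∈ 𝔞) ∧ RingTheory.Sequence.IsRegular L rs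

/-- grade(𝔞, L) : the length of a maximal L-regular sequence in 𝔞. -/
def grade {S : Type} [CommRing S] (𝔞 : Ideal S) (L : Type) [AddCommGroup L]
    [Module S L] : ℕ∞ :=
  sSup { t : ℕ∞ | ∃ t' : ℕ, t = (t' : ℕ∞) ∧ GradeGE 𝔞 L t' }

/-- depth of a module over a local ring: grade(𝔪, L). -/
def depth (S : Type) [CommRing S] [IsLocalRing S] (L : Type) [AddCommGroup L]
    [Module S L] : ℕ∞ :=
  grade (IsLocalRing.maximalIdeal S) L

/-- proj dim L ≤ d : L admits a finite free resolution of length ≤ d, encoded as a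
(possibly infinite) free resolution ⋯ → F_1 → F_0 → L → 0 with F_j = 0 for j > d. -/
def ProjDimLE (S : Type) [CommRing S] (L : Type) [AddCommGroup L] [Module S L]
    (d : ℕ) : Prop :=
  ∃ (r : ℕ → ℕ) (A : ∀ j : ℕ, Matrix (Fin (r j)) (Fin (r (j + 1))) S)
    (π : (Fin (r 0) → S) →ₗ[S] L),
    Function.Surjective π ∧ LinearMap.ker π = LinearMap.range (A 0).mulVecLin ∧
    (∀ j : ℕ, LinearMap.ker (A j).mulVecLin = LinearMap.range (A (j + 1)).mulVecLin) ∧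
    ∀ j : ℕ, d < j → r j = 0

/-- projective dimension of a module, as an extended natural number. -/
def projDim (S : Type) [CommRing S] (L : Type) [AddCommGroup L] [Module S L] : ℕ∞ :=
  sInf { d : ℕ∞ | ∃ d' : ℕ, d = (d' : ℕ∞) ∧ ProjDimLE S L d' }

/-- the i-th local cohomology module H^i_𝔞(L) as a module. -/
abbrev localCoh {S : Type} [CommRing S] (𝔞 : Ideal S) (i : ℕ) (L : Type)
    [AddCommGroup L] [Module S L] : ModuleCat S :=
  (localCohomology 𝔞 i).obj (ModuleCat.of S L)

/-- the colon submodule (0 :_L 𝔞) = { x ∈ L | 𝔞 x = 0 }. -/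
def colonSubmodule {S : Type} [CommRing S] (𝔞 : Ideal S) (L : Type) [AddCommGroup L]
    [Module S L] : Submodule S L where
  carrier := { x | ∀ c ∈ 𝔞, c • x = 0 }
  add_mem' := by
    intro a b ha hb c hc
    rw [smul_add, ha c hc, hb c hc, add_zero]
  zero_mem' := by
    intro c _
    rw [smul_zero]
  smul_mem' := by
    intro s x hx c hc
    rw [smul_comm, hx c hc, smul_zero]

/-- a (partial) system of parameters: the d = dim L elements a_1, ..., a_d lie in the
maximal ideal and L/(a_1, ..., a_d)L has dimension ≤ 0. -/
def IsSOP (S : Type) [CommRing S] [IsLocalRing S] (L : Type) [AddCommGroup L]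
    [Module S L] {d : ℕ} (a : Fin d → S) : Prop :=
  (∀ i, a i ∈ IsLocalRing.maximalIdeal S) ∧
  moduleDim S L = (d : ℕ∞) ∧
  moduleDim S (L ⧸ (Ideal.span (Set.range a) • (⊤ : Submodule S L))) ≤ 0

/-- a standard system of parameters: (a_1, ..., a_d) H^i_𝔪(L/(a_1, ..., a_j)L) = 0
for all i + j < d. -/
def IsStandardSOP (S : Type) [CommRing S] [IsLocalRing S] (L : Type) [AddCommGroup L]
    [Module S L] {d : ℕ} (a : Fin d → S) : Prop :=
  IsSOP S L a ∧
  ∀ i j : ℕ, i + j < d →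
    Ideal.span (Set.range a) ≤ Module.annihilator S
      (localCoh (IsLocalRing.maximalIdeal S) i
        (L ⧸ (Ideal.span (a '' { x : Fin d | (x : ℕ) < j }) • (⊤ : Submodule S L))))

/-- a standard ideal for L: an 𝔪-primary ideal 𝔞 such that every system of
parameters of L contained in 𝔞 is standard. -/
def IsStandardIdeal (S : Type) [CommRing S] [IsLocalRing S] (L : Type) [AddCommGroup L]
    [Module S L] (𝔞 : Ideal S) : Prop :=
  𝔞.radical = IsLocalRing.maximalIdeal S ∧
  ∀ (d : ℕ) (a : Fin d → S), (∀ i, a i ∈ 𝔞) → IsSOP S L a → IsStandardSOP S L a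

end Spl

theorem Ideal.exists_lt_natCast_le_height {R : Type*} [CommRing R] {p : Ideal R} [p.IsPrime]
    {n : ℕ} (h : ((n + 1 : ℕ) : ℕ∞) ≤ p.height) :
    ∃ q : Ideal R, q.IsPrime ∧ q < p ∧ (n : ℕ∞) ≤ q.height := by
  by_contra! H
  have := Ideal.height_le_iff.mpr H
  have := h.trans this
  exact absurd (by exact_mod_cast this) (Nat.not_succ_le_self n)

theorem Ideal.height_map_mk_add_le {R : Type*} [CommRing R] {q p : Ideal R}
    [q.IsPrime] [p.IsPrime] (hqp : q ≤ p) :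
    (p.map (Ideal.Quotient.mk q)).height + q.height ≤ p.height := by
  suffices H : ∀ (n : ℕ) (p : Ideal R), p.IsPrime → q ≤ p →
      (n : ℕ∞) ≤ (p.map (Ideal.Quotient.mk q)).height → n + q.height ≤ p.height by
    by_cases htop : (p.map (Ideal.Quotient.mk q)).height = ⊤
    · have : p.height = ⊤ := by
        refine ENat.eq_top_iff_forall_ge.mpr fun n => ?_
        exact le_self_add.trans (H n p ‹_› hqp (htop ▸ le_top))
      simp [this]
    · obtain ⟨n, hn⟩ := ENat.ne_top_iff_exists.mp htop
      rw [← hn]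
      exact H n p ‹_› hqp hn.le
  intro n
  induction n with
  | zero => intro p _ hqp _; simpa using Ideal.height_mono hqp
  | succ n ih =>
    intro p hp hqp hn
    have : (p.map (Ideal.Quotient.mk q)).IsPrime :=
      Ideal.isPrime_map_quotientMk_of_isPrime hqp
    obtain ⟨r, hr, hrp, hnr⟩ := Ideal.exists_lt_natCast_le_height hn
    have hs := Ideal.Quotient.mk_surjective (I := q)
    have hr' : (r.comap (Ideal.Quotient.mk q)).IsPrime := inferInstance
    have h1 := ih (r.comap (Ideal.Quotient.mk q)) hr'
      (fun x hx => by simp [Ideal.mem_comap, Ideal.Quotient.eq_zero_iff_mem.mpr hx])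
      (by rwa [Ideal.map_comap_of_surjective _ hs])
    have hlt : r.comap (Ideal.Quotient.mk q) < p := by
      have : p = (p.map (Ideal.Quotient.mk q)).comap (Ideal.Quotient.mk q) := by
        rw [Ideal.comap_map_of_surjective _ hs]
        symm; rw [sup_eq_left]
        exact (Ideal.mk_ker (I := q)).le.trans hqp
      rw [this]
      exact (Ideal.comap_mono hrp.le).lt_of_ne
        fun h => hrp.ne (Ideal.comap_injective_of_surjective _ hs h)
    calc ((n + 1 : ℕ) : ℕ∞) + q.height = n + q.height + 1 := by push_cast; ring
      _ ≤ _ := by gcongr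
      _ ≤ _ := Ideal.height_add_one_le_of_lt_of_isPrime hlt

theorem Ideal.height_under_eq_of_isIntegral {R S : Type*} [CommRing R] [CommRing S] [Algebra R S]
    [IsNoetherianRing R] [IsNoetherianRing S] [IsDomain S] [FaithfulSMul R S]
    [Algebra.IsIntegral R S] [IsIntegrallyClosed R] (P : Ideal S) [P.IsPrime] :
    (P.under R).height = P.height := by
  rw [Ideal.height_eq_height_add_of_liesOver_of_hasGoingDown (P.under R) P]
  have hle : (P.under R).map (algebraMap R S) ≤ P := Ideal.map_comap_le
  have : (P.map (Ideal.Quotient.mk ((P.under R).map (algebraMap R S)))).IsPrime :=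
    Ideal.isPrime_map_quotientMk_of_isPrime hle
  have h0 : (P.map (Ideal.Quotient.mk ((P.under R).map (algebraMap R S)))).height = 0 := by
    rw [Ideal.height_eq_zero_iff]
    have h2 := Ideal.IsIntegral.mem_minimalPrimes_map_under (R := R) (A := S) P
    rw [Ideal.minimalPrimes_eq_comap] at h2
    obtain ⟨r, hr, hrP⟩ := h2
    have : P.map (Ideal.Quotient.mk ((P.under R).map (algebraMap R S))) = r := by
      refine Eq.trans ?_ (Ideal.map_comap_of_surjective _ Ideal.Quotient.mk_surjective r)
      rw [hrP]
    rwa [this]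
  rw [h0, add_zero]

theorem MvPolynomial.height_eq_of_isMaximal {F : Type*} [Field F] (d : ℕ)
    (M : Ideal (MvPolynomial (Fin d) F)) [hM : M.IsMaximal] : M.height = d := by
  induction d with
  | zero =>
    have : M = ⊥ := by
      have e := (MvPolynomial.isEmptyAlgEquiv F (Fin 0)).toRingEquiv
      let : IsField (MvPolynomial (Fin 0) F) :=
        e.toMulEquiv.isField (Field.toIsField F)
      let := this.toField
      exact (Ideal.eq_bot_or_top M).resolve_right hM.ne_top
    simp [this]
  | succ d ih =>
    let e := (MvPolynomial.finSuccEquiv F d).toRingEquiv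
    rw [← RingEquiv.height_map e]
    have hM' : (M.map e).IsMaximal := Ideal.map_isMaximal_of_equiv e
    obtain ⟨N, hN⟩ : ∃ N : Ideal (Polynomial (MvPolynomial (Fin d) F)), N = M.map e := ⟨_, rfl⟩
    rw [← hN] at hM' ⊢
    have h1 : (N.under (MvPolynomial (Fin d) F)).IsMaximal :=
      Polynomial.isMaximal_comap_C_of_isJacobsonRing N
    rw [Polynomial.height_eq_height_add_one (N.under (MvPolynomial (Fin d) F)) N, ih]
    simp

section

variable (F : Type) [Field F]

/-- The transcendence degree, as a natural number. -/
def natTrdeg (D : Type) [CommRing D] [Algebra F D] : ℕ :=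
  (Algebra.trdeg F D).toNat

theorem natTrdeg_cast (D : Type) [CommRing D] [Algebra F D] [Algebra.FiniteType F D] :
    (natTrdeg F D : Cardinal) = Algebra.trdeg F D :=
  Cardinal.cast_toNat_of_lt_aleph0 trdeg_lt_aleph0_of_finiteType

variable {F} in
theorem natTrdeg_congr {D E : Type} [CommRing D] [Algebra F D] [CommRing E] [Algebra F E]
    (e : D ≃ₐ[F] E) : natTrdeg F D = natTrdeg F E := by
  rw [natTrdeg, natTrdeg, e.trdeg_eq]

theorem natTrdeg_mvPolynomial (d : ℕ) : natTrdeg F (MvPolynomial (Fin d) F) = d := by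
  rw [natTrdeg, MvPolynomial.trdeg_of_isDomain]; simp

theorem natTrdeg_eq_of_isIntegral (D E : Type) [CommRing D] [Algebra F D] [CommRing E]
    [Algebra F E] [Algebra D E] [IsScalarTower F D E] [IsDomain E] [FaithfulSMul D E]
    [Algebra.IsIntegral D E] : natTrdeg F D = natTrdeg F E := by
  have : Nontrivial D := (algebraMap D E).domain_nontrivial
  rw [natTrdeg, natTrdeg, ← trdeg_add_eq F D (A := E)]
  have : Algebra.IsAlgebraic D E := inferInstance
  rw [trdeg_eq_zero (R := D) (A := E), add_zero]

variable {F} in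
theorem height_eq_natTrdeg_of_isMaximal {D : Type} [CommRing D] [IsDomain D] [Algebra F D]
    [Algebra.FiniteType F D] (M : Ideal D) [hM : M.IsMaximal] : M.height = natTrdeg F D := by
  have : IsNoetherianRing D := Algebra.FiniteType.isNoetherianRing F D
  obtain ⟨s, g, hinj, hint⟩ := exists_integral_inj_algHom_of_fg F D
  algebraize [g.toRingHom]
  have : IsScalarTower F (MvPolynomial (Fin s) F) D := .of_algHom g
  have : FaithfulSMul (MvPolynomial (Fin s) F) D :=
    (faithfulSMul_iff_algebraMap_injective _ _).mpr hinj
  have hM' : (M.under (MvPolynomial (Fin s) F)).IsMaximal :=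
    Ideal.isMaximal_comap_of_isIntegral_of_isMaximal M
  rw [← Ideal.height_under_eq_of_isIntegral (R := MvPolynomial (Fin s) F) M,
    MvPolynomial.height_eq_of_isMaximal, ← natTrdeg_eq_of_isIntegral F (MvPolynomial (Fin s) F) D,
    natTrdeg_mvPolynomial]

variable {F} in
theorem natTrdeg_quotient_add_height_le {D : Type} [CommRing D] [IsDomain D] [Algebra F D]
    [Algebra.FiniteType F D] (P : Ideal D) [P.IsPrime] :
    natTrdeg F (D ⧸ P) + P.height ≤ natTrdeg F D := by
  obtain ⟨M, hM, hPM⟩ := P.exists_le_maximal Ideal.IsPrime.ne_top'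
  have hM' : (M.map (Ideal.Quotient.mk P)).IsMaximal := by
    refine (Ideal.map_eq_top_or_isMaximal_of_surjective _ Ideal.Quotient.mk_surjective
      hM).resolve_left ?_
    exact (Ideal.isPrime_map_quotientMk_of_isPrime hPM).ne_top
  rw [← height_eq_natTrdeg_of_isMaximal M,
    ← height_eq_natTrdeg_of_isMaximal (M.map (Ideal.Quotient.mk P))]
  exact Ideal.height_map_mk_add_le hPM

variable {F} in
theorem natTrdeg_le_natTrdeg_quotient_add_height {D : Type} [CommRing D] [IsDomain D] [Algebra F D]
    [Algebra.FiniteType F D] (P : Ideal D) [P.IsPrime] :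
    natTrdeg F D ≤ natTrdeg F (D ⧸ P) + P.height := by
  obtain ⟨N, hN⟩ : ∃ N, N = natTrdeg F D := ⟨_, rfl⟩
  induction N using Nat.strong_induction_on generalizing D with
  | _ N ih =>
  have : IsNoetherianRing D := Algebra.FiniteType.isNoetherianRing F D
  obtain ⟨s, g, hinj, hint⟩ := exists_integral_inj_algHom_of_fg F D
  algebraize [g.toRingHom]
  have : IsScalarTower F (MvPolynomial (Fin s) F) D := .of_algHom g
  have : FaithfulSMul (MvPolynomial (Fin s) F) D :=
    (faithfulSMul_iff_algebraMap_injective _ _).mpr hinj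
  have h1 := natTrdeg_eq_of_isIntegral F (MvPolynomial (Fin s) F) D
  have h2 : natTrdeg F (MvPolynomial (Fin s) F ⧸ P.under (MvPolynomial (Fin s) F)) =
      natTrdeg F (D ⧸ P) := natTrdeg_eq_of_isIntegral F _ _
  rw [← h1, ← h2, ← Ideal.height_under_eq_of_isIntegral (R := MvPolynomial (Fin s) F) P]
  rw [← h1] at hN
  have hP0 : (P.under (MvPolynomial (Fin s) F)).IsPrime := inferInstance
  generalize P.under (MvPolynomial (Fin s) F) = P0 at hP0 ⊢
  clear h1 h2
  by_cases hbot : P0 = ⊥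
  · subst hbot
    rw [natTrdeg_congr (AlgEquiv.quotientBot F (MvPolynomial (Fin s) F))]
    exact le_self_add
  obtain ⟨f, hf, hfp⟩ := hP0.exists_mem_prime_of_ne_bot hbot
  have hI : (Ideal.span {f}).IsPrime := (Ideal.span_singleton_prime hfp.ne_zero).mpr hfp
  have hIP : Ideal.span {f} ≤ P0 := (Ideal.span_singleton_le_iff_mem _).mpr hf
  have hht : 1 ≤ (Ideal.span {f}).height := by
    rw [Order.one_le_iff_ne_zero, Ne, Ideal.height_eq_zero_iff_eq_bot, Ideal.span_singleton_eq_bot]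
    exact hfp.ne_zero
  have hlt : natTrdeg F (MvPolynomial (Fin s) F ⧸ Ideal.span {f}) + 1 ≤
      natTrdeg F (MvPolynomial (Fin s) F) := by
    have := natTrdeg_quotient_add_height_le (F := F) (Ideal.span {f})
    have := (add_le_add_right hht _).trans this
    exact_mod_cast this
  have hP1 : (P0.map (Ideal.Quotient.mk (Ideal.span {f}))).IsPrime :=
    Ideal.isPrime_map_quotientMk_of_isPrime hIP
  have key := ih _ (by omega) (P0.map (Ideal.Quotient.mk (Ideal.span {f}))) rfl
  have e : natTrdeg F ((MvPolynomial (Fin s) F ⧸ Ideal.span {f}) ⧸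
      P0.map (Ideal.Quotient.mk (Ideal.span {f}))) = natTrdeg F (MvPolynomial (Fin s) F ⧸ P0) :=
    natTrdeg_congr (DoubleQuot.quotQuotEquivQuotOfLEₐ F hIP)
  rw [e] at key
  have hup : natTrdeg F (MvPolynomial (Fin s) F) ≤
      natTrdeg F (MvPolynomial (Fin s) F ⧸ Ideal.span {f}) + 1 := by
    obtain ⟨M, hM, hPM⟩ := (Ideal.span {f}).exists_le_maximal Ideal.IsPrime.ne_top'
    have hM' : (M.map (Ideal.Quotient.mk (Ideal.span {f}))).IsMaximal := by
      refine (Ideal.map_eq_top_or_isMaximal_of_surjective _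
        Ideal.Quotient.mk_surjective
      hM).resolve_left ?_
      exact (Ideal.isPrime_map_quotientMk_of_isPrime hPM).ne_top
    have h3 := Ideal.height_le_height_add_spanFinrank_of_le hPM
    rw [height_eq_natTrdeg_of_isMaximal (F := F) M,
      height_eq_natTrdeg_of_isMaximal (F := F) (M.map (Ideal.Quotient.mk (Ideal.span {f})))] at h3
    have h4 : (Ideal.span {f}).spanFinrank ≤ 1 := by
      simpa using Submodule.spanFinrank_span_le_ncard_of_finite (R := MvPolynomial (Fin s) F)
        (Set.finite_singleton f)
    have h5 : natTrdeg F (MvPolynomial (Fin s) F) ≤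
      natTrdeg F (MvPolynomial (Fin s) F ⧸ Ideal.span {f}) + (Ideal.span {f}).spanFinrank := by
      exact_mod_cast h3
    omega
  calc (natTrdeg F (MvPolynomial (Fin s) F) : ℕ∞)
      ≤ natTrdeg F (MvPolynomial (Fin s) F ⧸ Ideal.span {f}) + 1 := by exact_mod_cast hup
    _ ≤ _ := add_le_add_left key 1
    _ ≤ natTrdeg F (MvPolynomial (Fin s) F ⧸ P0) +
        ((P0.map (Ideal.Quotient.mk (Ideal.span {f}))).height + (Ideal.span {f}).height) := by
      rw [add_assoc]; gcongr
    _ ≤ _ := by gcongr; exact Ideal.height_map_mk_add_le hIP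

variable {F} in
theorem natTrdeg_quotient_add_height {D : Type} [CommRing D] [IsDomain D] [Algebra F D]
    [Algebra.FiniteType F D] (P : Ideal D) [P.IsPrime] :
    natTrdeg F (D ⧸ P) + P.height = natTrdeg F D :=
  (natTrdeg_quotient_add_height_le P).antisymm (natTrdeg_le_natTrdeg_quotient_add_height P)

theorem Ideal.height_map_mk_add_eq {D : Type} [CommRing D] [IsDomain D] [Algebra F D]
    [Algebra.FiniteType F D] {q p : Ideal D} [q.IsPrime] [p.IsPrime] (hqp : q ≤ p) :
    (p.map (Ideal.Quotient.mk q)).height + q.height = p.height := by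
  have hp' : (p.map (Ideal.Quotient.mk q)).IsPrime :=
    Ideal.isPrime_map_quotientMk_of_isPrime hqp
  have h1 := natTrdeg_quotient_add_height (F := F) p
  have h2 := natTrdeg_quotient_add_height (F := F) q
  have h3 := natTrdeg_quotient_add_height (F := F) (p.map (Ideal.Quotient.mk q))
  have e : natTrdeg F ((D ⧸ q) ⧸ p.map (Ideal.Quotient.mk q)) = natTrdeg F (D ⧸ p) :=
    natTrdeg_congr (DoubleQuot.quotQuotEquivQuotOfLEₐ F hqp)
  rw [e] at h3
  rw [← h3, ← h1, add_assoc] at h2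
  exact ENat.add_left_injective_of_ne_top (ENat.natCast_ne_top (natTrdeg F (D ⧸ p)))
    (by simpa [add_comm] using h2)

variable {F} in
theorem MvPolynomial.algebraicIndependent_mk_X_iff {n : ℕ}
    (p : Ideal (MvPolynomial (Fin n) F)) (s : Set (Fin n)) :
    AlgebraicIndependent F (fun i : s => Ideal.Quotient.mk p (X i.1)) ↔
      ∀ f : MvPolynomial s F, rename (Subtype.val) f ∈ p → f = 0 := by
  rw [algebraicIndependent_iff]
  refine forall_congr' fun f => ?_
  have : aeval (fun i : s => Ideal.Quotient.mk p (X i.1)) f =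
      Ideal.Quotient.mkₐ F p (rename (Subtype.val) f) := by
    rw [← AlgHom.comp_apply]
    congr 1
    ext i
    simp
  rw [this, Ideal.Quotient.mkₐ_eq_mk, Ideal.Quotient.eq_zero_iff_mem]

variable {F} in
/-- For a prime `p` of a polynomial ring in `n` variables, there is a set of `n - height p`
variables that is algebraically independent modulo `p`. -/
theorem MvPolynomial.exists_set_rename_mem_imp_eq_zero {n : ℕ}
    (p : Ideal (MvPolynomial (Fin n) F)) [p.IsPrime] :
    ∃ s : Set (Fin n), (s.ncard : ℕ∞) + p.height = n ∧
      ∀ f : MvPolynomial s F, rename (Subtype.val) f ∈ p → f = 0 := by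
  let x : Fin n → MvPolynomial (Fin n) F ⧸ p := fun i => Ideal.Quotient.mk p (X i)
  have htop : Algebra.adjoin F (Set.range x) = ⊤ := by
    have h1 := MvPolynomial.adjoin_range_X (R := F) (σ := Fin n)
    have h2 := congrArg (Subalgebra.map (Ideal.Quotient.mkₐ F p)) h1
    rw [AlgHom.map_adjoin, ← Set.range_comp, Algebra.map_top,
      (AlgHom.range_eq_top _).mpr (Ideal.Quotient.mkₐ_surjective F p)] at h2
    exact h2
  have : Algebra.IsAlgebraic (Algebra.adjoin F (Set.range x)) (MvPolynomial (Fin n) F ⧸ p) := by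
    constructor
    intro y
    have hy : y ∈ Algebra.adjoin F (Set.range x) := htop ▸ Algebra.mem_top
    exact isAlgebraic_algebraMap (⟨y, hy⟩ : Algebra.adjoin F (Set.range x))
  obtain ⟨t, ht, hb⟩ := exists_isTranscendenceBasis_subset (R := F) (Set.range x)
  obtain ⟨u, -, hu⟩ := Set.SurjOn.exists_bijOn_subset
    (f := x) (s := Set.univ) (t := t) (fun y hy => by simpa using ht hy)
  have hb' : IsTranscendenceBasis F (fun i : u => x i) := hb.comp_equiv (hu.equiv x)
  refine ⟨u, ?_, (algebraicIndependent_mk_X_iff p u).mp hb'.1⟩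
  have hcard := hb'.cardinalMk_eq_trdeg
  have hn : natTrdeg F (MvPolynomial (Fin n) F ⧸ p) = u.ncard := by
    rw [natTrdeg, ← hcard]; rfl
  rw [← hn, natTrdeg_quotient_add_height, natTrdeg_mvPolynomial]

variable {F} in
theorem MvPolynomial.ncard_add_height_le {n : ℕ} (p : Ideal (MvPolynomial (Fin n) F)) [p.IsPrime]
    (s : Set (Fin n))
    (hs : ∀ f : MvPolynomial s F, rename (Subtype.val) f ∈ p → f = 0) :
    (s.ncard : ℕ∞) + p.height ≤ n := by
  have h := ((algebraicIndependent_mk_X_iff p s).mpr hs).cardinalMk_le_trdeg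
  rw [← natTrdeg_cast] at h
  have h1 := natTrdeg_quotient_add_height (F := F) p
  rw [natTrdeg_mvPolynomial] at h1
  rw [← h1]
  gcongr
  have : (s.ncard : Cardinal) = Cardinal.mk s := by
    rw [← Nat.card_coe_set_eq, Nat.cast_card]
  rw [← this] at h
  exact_mod_cast h

end

namespace MvPolynomial

section

variable {A L : Type} [CommRing A] [Field L] (φ : A →+* L) {n : ℕ}

/-- Every element of the field `L` is a fraction of two elements of the image of `φ`. -/
def FracSurjective : Prop := ∀ x : L, ∃ a b : A, φ b ≠ 0 ∧ φ b * x = φ a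

variable {φ}

theorem exists_C_mul_eq_map {σ : Type} (hφ : FracSurjective φ) (h : MvPolynomial σ L) :
    ∃ s : A, φ s ≠ 0 ∧ ∃ h' : MvPolynomial σ A, C (φ s) * h = map φ h' := by
  induction h using MvPolynomial.induction_on with
  | C a =>
    obtain ⟨x, y, hy, h⟩ := hφ a
    exact ⟨y, hy, C x, by rw [map_C, ← h, C_mul]⟩
  | add p q hp hq =>
    obtain ⟨s, hs, p', hp⟩ := hp
    obtain ⟨t, ht, q', hq⟩ := hq
    refine ⟨s * t, by rw [map_mul]; exact mul_ne_zero hs ht, C t * p' + C s * q', ?_⟩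
    simp only [map_add, map_mul, map_C, ← hp, ← hq]
    ring
  | mul_X p i hp =>
    obtain ⟨s, hs, p', hp⟩ := hp
    exact ⟨s, hs, p' * X i, by rw [map_mul, map_X, ← hp, mul_assoc]⟩

theorem exists_C_mul_eq_map_of_mem (hφ : FracSurjective φ) {I : Ideal (MvPolynomial (Fin n) A)}
    {x : MvPolynomial (Fin n) L} (hx : x ∈ I.map (map φ)) :
    ∃ s : A, φ s ≠ 0 ∧ ∃ w ∈ I, C (φ s) * x = map φ w := by
  induction hx using Submodule.span_induction with
  | mem x hx =>
    obtain ⟨w, hw, rfl⟩ := hx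
    exact ⟨1, by simp, w, hw, by simp⟩
  | zero => exact ⟨1, by simp, 0, I.zero_mem, by simp⟩
  | add x y _ _ hx hy =>
    obtain ⟨s, hs, p', hp', hp⟩ := hx
    obtain ⟨t, ht, q', hq', hq⟩ := hy
    refine ⟨s * t, by rw [map_mul]; exact mul_ne_zero hs ht, C t * p' + C s * q',
      I.add_mem (I.mul_mem_left _ hp') (I.mul_mem_left _ hq'), ?_⟩
    simp only [map_add, map_mul, map_C, ← hp, ← hq]
    ring
  | smul a x _ hx =>
    obtain ⟨s, hs, p', hp', hp⟩ := hx
    obtain ⟨t, ht, a', ha⟩ := exists_C_mul_eq_map hφ a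
    refine ⟨s * t, by rw [map_mul]; exact mul_ne_zero hs ht, a' * p', I.mul_mem_left _ hp', ?_⟩
    simp only [smul_eq_mul, map_mul, ← hp, ← ha]
    ring

theorem C_notMem_of_ne_zero {Q : Ideal (MvPolynomial (Fin n) L)} [hQ : Q.IsPrime] {x : L}
    (hx : x ≠ 0) : C x ∉ Q := fun h =>
  hQ.ne_top (Ideal.eq_top_of_isUnit_mem _ h ((isUnit_iff_ne_zero.mpr hx).map C))

theorem comap_C_comap_map {Q : Ideal (MvPolynomial (Fin n) L)} [Q.IsPrime] :
    (Q.comap (map φ)).comap C = RingHom.ker φ := by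
  ext a
  rw [Ideal.mem_comap, Ideal.mem_comap, map_C, RingHom.mem_ker]
  refine ⟨fun h => ?_, fun h => by simp [h]⟩
  by_contra h0
  exact C_notMem_of_ne_zero h0 h

theorem ker_map_eq : RingHom.ker (map φ : MvPolynomial (Fin n) A →+* MvPolynomial (Fin n) L) =
    (RingHom.ker φ).map C := by
  rw [ker_map]

theorem height_comap_map [IsNoetherianRing A] (hφ : FracSurjective φ)
    (Q : Ideal (MvPolynomial (Fin n) L)) [Q.IsPrime] :
    (Q.comap (map φ)).height = (RingHom.ker φ).height + Q.height := by
  have hprime : (RingHom.ker φ).IsPrime := RingHom.ker_isPrime φ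
  have hover : (Q.comap (map φ)).LiesOver (RingHom.ker φ) := ⟨(comap_C_comap_map (Q := Q)).symm⟩
  rw [Ideal.height_eq_height_add_of_liesOver_of_hasGoingDown (RingHom.ker φ)]
  congr 1
  let J := (RingHom.ker φ).map (algebraMap A (MvPolynomial (Fin n) A))
  have hJ : RingHom.ker (map φ : MvPolynomial (Fin n) A →+* MvPolynomial (Fin n) L) = J :=
    ker_map_eq
  let g : (MvPolynomial (Fin n) A ⧸ J) →+* MvPolynomial (Fin n) L :=
    Ideal.Quotient.lift J (map φ) (fun a ha => by rw [← hJ] at ha; exact ha)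
  have hg : Function.Injective g := by
    refine RingHom.lift_injective_of_ker_le_ideal _ _ hJ.le
  let _ : Algebra (MvPolynomial (Fin n) A ⧸ J) (MvPolynomial (Fin n) L) := g.toAlgebra
  let M : Submonoid (MvPolynomial (Fin n) A ⧸ J) :=
    (RingHom.ker φ).primeCompl.map ((Ideal.Quotient.mk J).comp C)
  have hloc : IsLocalization M (MvPolynomial (Fin n) L) := by
    refine ⟨⟨?_, ?_, ?_⟩⟩
    · rintro ⟨_, s, hs, rfl⟩
      have : algebraMap (MvPolynomial (Fin n) A ⧸ J) (MvPolynomial (Fin n) L)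
        ((Ideal.Quotient.mk J).comp C s) = C (φ s) := map_C _ _
      rw [this]
      exact (isUnit_iff_ne_zero.mpr hs).map C
    · intro h
      obtain ⟨s, hs, h', e⟩ := exists_C_mul_eq_map hφ h
      refine ⟨⟨Ideal.Quotient.mk J h', ⟨_, s, hs, rfl⟩⟩, ?_⟩
      have : algebraMap (MvPolynomial (Fin n) A ⧸ J) (MvPolynomial (Fin n) L)
        ((Ideal.Quotient.mk J).comp C s) = C (φ s) := map_C _ _
      change h * algebraMap (MvPolynomial (Fin n) A ⧸ J) (MvPolynomial (Fin n) L)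
        ((Ideal.Quotient.mk J).comp C s) = map φ h'
      rw [this, ← e, mul_comm]
    · intro x y h
      exact ⟨1, by rw [hg h]⟩
  rw [← IsLocalization.height_under M Q]
  have : (Q.under (MvPolynomial (Fin n) A ⧸ J)).comap (Ideal.Quotient.mk J) = Q.comap (map φ) := by
    rw [Ideal.under, Ideal.comap_comap]
    rfl
  rw [← this, Ideal.map_comap_of_surjective _ Ideal.Quotient.mk_surjective]

theorem isPrime_map_map (hφ : FracSurjective φ)
    {q : Ideal (MvPolynomial (Fin n) A)} [hq : q.IsPrime]
    (hker : RingHom.ker (map φ : MvPolynomial (Fin n) A →+* MvPolynomial (Fin n) L) ≤ q)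
    (hC : ∀ s, C s ∈ q → φ s = 0) :
    (q.map (map φ)).IsPrime ∧ (q.map (map φ)).comap (map φ) = q := by
  have hcomap : (q.map (map φ)).comap (map φ) = q := by
    refine le_antisymm (fun x hx => ?_) Ideal.le_comap_map
    obtain ⟨s, hs, w, hw, e⟩ := exists_C_mul_eq_map_of_mem hφ hx
    have h1 : C s * x - w ∈ q := hker (by
      rw [RingHom.mem_ker, map_sub, map_mul, map_C, e, sub_self])
    have h2 : C s * x ∈ q := by simpa using q.add_mem h1 hw
    exact (hq.mem_or_mem h2).resolve_left fun h => hs (hC s h)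
  have hunit : ∀ s x, φ s ≠ 0 → C (φ s) * x ∈ q.map (map φ) → x ∈ q.map (map φ) := by
    intro s x hs hx
    exact ((q.map (map φ)).unit_mul_mem_iff_mem ((isUnit_iff_ne_zero.mpr hs).map C)).mp hx
  refine ⟨⟨?_, ?_⟩, hcomap⟩
  · intro h
    rw [h, Ideal.comap_top] at hcomap
    exact hq.ne_top hcomap.symm
  · intro x y hxy
    obtain ⟨s, hs, x', hx⟩ := exists_C_mul_eq_map hφ x
    obtain ⟨t, ht, y', hy⟩ := exists_C_mul_eq_map hφ y
    have : x' * y' ∈ q := by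
      rw [← hcomap, Ideal.mem_comap, map_mul, ← hx, ← hy]
      have : C (φ s) * x * (C (φ t) * y) = (C (φ s) * C (φ t)) * (x * y) := by ring
      rw [this]
      exact Ideal.mul_mem_left _ _ hxy
    rcases hq.mem_or_mem this with h | h
    · left
      exact hunit s x hs (hx ▸ Ideal.mem_map_of_mem _ h)
    · right
      exact hunit t y ht (hy ▸ Ideal.mem_map_of_mem _ h)

theorem height_le_of_mem_minimalPrimes_map {F : Type} [Field F] [Algebra F A] [IsDomain A]
    [Algebra.FiniteType F A] (hφ : FracSurjective φ)
    (p : Ideal (MvPolynomial (Fin n) A)) [p.IsPrime]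
    {Q : Ideal (MvPolynomial (Fin n) L)} (hQ : Q ∈ (p.map (map φ)).minimalPrimes) :
    Q.height ≤ p.height := by
  have : IsNoetherianRing A := Algebra.FiniteType.isNoetherianRing F A
  have hQp : Q.IsPrime := hQ.isPrime
  have hkp : (RingHom.ker φ).IsPrime := RingHom.ker_isPrime φ
  have hle : p ≤ Q.comap (map φ) := Ideal.map_le_iff_le_comap.mp hQ.1.2
  have hfin : Algebra.FiniteType F (MvPolynomial (Fin n) A) :=
    .trans (S := A) inferInstance inferInstance
  have h1 := Ideal.height_map_mk_add_eq (F := F) hle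
  rw [height_comap_map hφ] at h1
  have hPp : ((Q.comap (map φ)).map (Ideal.Quotient.mk p)).IsPrime :=
    Ideal.isPrime_map_quotientMk_of_isPrime hle
  have hcm : ((Q.comap (map φ)).map (Ideal.Quotient.mk p)).comap (Ideal.Quotient.mk p) =
      Q.comap (map φ) := by
    rw [Ideal.comap_map_of_surjective _ Ideal.Quotient.mk_surjective, sup_eq_left]
    exact (Ideal.mk_ker (I := p)).le.trans hle
  generalize hP : (Q.comap (map φ)).map (Ideal.Quotient.mk p) = P at *
  have hover : P.LiesOver (RingHom.ker φ) := by
    refine ⟨?_⟩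
    rw [← comap_C_comap_map (Q := Q), ← hcm, Ideal.comap_comap]
    rfl
  have h2 := Ideal.height_le_height_add_of_liesOver (RingHom.ker φ) P
  set J := (RingHom.ker φ).map (algebraMap A (MvPolynomial (Fin n) A ⧸ p)) with hJ
  have hJP : J ≤ P := by
    rw [hJ, Ideal.map_le_iff_le_comap]
    exact hover.over.le
  have hP'p : (P.map (Ideal.Quotient.mk J)).IsPrime := Ideal.isPrime_map_quotientMk_of_isPrime hJP
  have h3 : (P.map (Ideal.Quotient.mk J)).height = 0 := by
    rw [Ideal.height_eq_zero_iff]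
    refine ⟨⟨hP'p, bot_le⟩, ?_⟩
    rintro r ⟨hr, -⟩ hrP
    have hrP' : r.comap (Ideal.Quotient.mk J) ≤ P := by
      refine (Ideal.comap_mono hrP).trans ?_
      rw [Ideal.comap_map_of_surjective _ Ideal.Quotient.mk_surjective, sup_le_iff]
      exact ⟨le_rfl, (Ideal.mk_ker (I := J)).le.trans hJP⟩
    have hJr : J ≤ r.comap (Ideal.Quotient.mk J) := fun x hx => by
      simp [Ideal.mem_comap, Ideal.Quotient.eq_zero_iff_mem.mpr hx]
    rw [Ideal.map_le_iff_le_comap]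
    have hrp : (r.comap (Ideal.Quotient.mk J)).IsPrime := inferInstance
    generalize r.comap (Ideal.Quotient.mk J) = r' at *
    have hq : (r'.comap (Ideal.Quotient.mk p)).IsPrime := inferInstance
    have hpq : p ≤ r'.comap (Ideal.Quotient.mk p) := fun x hx => by
      simp [Ideal.mem_comap, Ideal.Quotient.eq_zero_iff_mem.mpr hx]
    have hkq : RingHom.ker (map φ : MvPolynomial (Fin n) A →+* MvPolynomial (Fin n) L) ≤
        r'.comap (Ideal.Quotient.mk p) := by
      rw [ker_map_eq, ← Ideal.map_le_iff_le_comap, Ideal.map_map]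
      exact hJr
    have hqQ : r'.comap (Ideal.Quotient.mk p) ≤ Q.comap (map φ) := by
      rw [← hcm]
      exact Ideal.comap_mono hrP'
    suffices Q.comap (map φ) ≤ r'.comap (Ideal.Quotient.mk p) by
      rw [← hP, Ideal.map_le_iff_le_comap]
      exact this
    generalize r'.comap (Ideal.Quotient.mk p) = q at *
    obtain ⟨h4, h5⟩ := isPrime_map_map hφ hkq (fun s hs => by
      by_contra h0
      have := hqQ hs
      rw [Ideal.mem_comap, map_C] at this
      exact C_notMem_of_ne_zero h0 this)
    rw [← h5]
    exact Ideal.comap_mono (hQ.2 ⟨h4, Ideal.map_mono hpq⟩ (Ideal.map_le_iff_le_comap.mpr hqQ))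
  rw [h3, add_zero] at h2
  have h4 : (RingHom.ker φ).height ≠ ⊤ := Ideal.height_ne_top_of_isPrime
  have h5 : (RingHom.ker φ).height + Q.height ≤ (RingHom.ker φ).height + p.height := by
    rw [← h1]; gcongr
  exact (ENat.add_le_add_iff_left h4).mp h5

end

theorem fracSurjective_algebraMap (A E : Type) [CommRing A] [IsDomain A] [Field E] [Algebra A E]
    [IsFractionRing A E] : FracSurjective (algebraMap A E) := fun x => by
  obtain ⟨a, b, hb, rfl⟩ := IsFractionRing.div_surjective (A := A) x
  have hb' : algebraMap A E b ≠ 0 := IsFractionRing.to_map_ne_zero_of_mem_nonZeroDivisors hb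
  exact ⟨a, b, hb', mul_div_cancel₀ _ hb'⟩

section

variable {A E : Type} [CommRing A] [IsDomain A] [Field E] [Algebra A E] [IsFractionRing A E]
  {n : ℕ}

theorem exists_map_ne_zero_of_rename_mem (J : Ideal (MvPolynomial (Fin n) A)) (s : Set (Fin n)) :
    ∃ c : A, c ≠ 0 ∧ ∀ (L : Type) [Field L] (φ : A →+* L), φ c ≠ 0 →
      (∃ f : MvPolynomial s E, rename Subtype.val f ∈ J.map (map (algebraMap A E)) ∧ f ≠ 0) →
      ∃ g : MvPolynomial s A, rename Subtype.val g ∈ J ∧ map φ g ≠ 0 := by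
  by_cases hs : ∃ f : MvPolynomial s E, rename Subtype.val f ∈ J.map (map (algebraMap A E)) ∧ f ≠ 0
  · obtain ⟨f, hf, hf0⟩ := hs
    obtain ⟨a, ha, g, hg⟩ := exists_C_mul_eq_map (fracSurjective_algebraMap A E) f
    obtain ⟨b, hb, w, hw, hfw⟩ := exists_C_mul_eq_map_of_mem (fracSurjective_algebraMap A E) hf
    have hinj := map_injective (σ := Fin n) _ (IsFractionRing.injective A E)
    have hgJ : rename Subtype.val (C b * g) ∈ J := by
      have : rename Subtype.val (C b * g) = C a * w := hinj (by
        simp only [map_rename, map_mul, map_C, ← hg, ← hfw, rename_C]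
        ring)
      rw [this]
      exact J.mul_mem_left _ hw
    have hg0 : C b * g ≠ 0 := by
      intro h
      rw [mul_eq_zero, C_eq_zero] at h
      rcases h with rfl | rfl
      · exact hb (map_zero _)
      · rw [map_zero, mul_eq_zero, C_eq_zero] at hg
        exact hg.elim ha hf0
    obtain ⟨d, hd⟩ := exists_coeff_ne_zero hg0
    exact ⟨coeff d (C b * g), hd, fun L _ φ hφ _ => ⟨C b * g, hgJ, fun h => hφ (by
      rw [← coeff_map, h, coeff_zero])⟩⟩
  · exact ⟨1, one_ne_zero, fun _ _ _ _ h => (hs h).elim⟩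

theorem exists_height_map_le_of_map_le (J : Ideal (MvPolynomial (Fin n) A)) :
    ∃ c : A, c ≠ 0 ∧ ∀ (L : Type) [Field L] (φ : A →+* L), φ c ≠ 0 →
      ∀ p : Ideal (MvPolynomial (Fin n) L), p.IsPrime →
        J.map (map φ) ≤ p → (J.map (map (algebraMap A E))).height ≤ p.height := by
  classical
  choose c hc0 hc using exists_map_ne_zero_of_rename_mem (E := E) J
  refine ⟨∏ s : Set (Fin n), c s, Finset.prod_ne_zero_iff.mpr fun s _ => hc0 s,
    fun L _ φ hφ p hp hIp => ?_⟩
  obtain ⟨s, hs, hsp⟩ := exists_set_rename_mem_imp_eq_zero p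
  rw [map_prod, Finset.prod_ne_zero_iff] at hφ
  set I := J.map (map (algebraMap A E)) with hI'
  have hI : ∀ f : MvPolynomial s E, rename Subtype.val f ∈ I → f = 0 := by
    by_contra! h
    obtain ⟨g, hg, hg0⟩ := hc s L φ (hφ s (Finset.mem_univ s)) h
    exact hg0 (hsp _ (by
      rw [← map_rename]
      exact hIp (Ideal.mem_map_of_mem _ hg)))
  let M : Submonoid (MvPolynomial (Fin n) E) :=
    (nonZeroDivisors (MvPolynomial s E)).map (rename Subtype.val)
  have hdisj : Disjoint (I : Set (MvPolynomial (Fin n) E)) M := by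
    rw [Set.disjoint_left]
    rintro _ hx ⟨f, hf, rfl⟩
    exact nonZeroDivisors.ne_zero hf (hI f hx)
  obtain ⟨q, hq, hIq, hqM⟩ := Ideal.exists_le_prime_disjoint I M hdisj
  have h1 := ncard_add_height_le q s fun f hf => by
    by_contra hf0
    exact Set.disjoint_left.mp hqM hf ⟨f, mem_nonZeroDivisors_of_ne_zero hf0, rfl⟩
  rw [← hs] at h1
  exact (Ideal.height_mono hIq).trans ((ENat.add_le_add_iff_left (ENat.natCast_ne_top _)).mp h1)

end

end MvPolynomial

namespace MvPolynomial

variable {A : Type} [CommRing A] [IsDomain A] {n : ℕ}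

/-- Pseudo-division by an ideal `J` with respect to its set `T` of leading exponents. -/
theorem exists_pow_mul_eq_add (J : Ideal (MvPolynomial (Fin n) A)) :
    ∃ c : A, c ≠ 0 ∧ ∃ T : Set (Fin n →₀ ℕ), (∀ f ∈ J, f ≠ 0 → ∃ d ∈ T, coeff d f ≠ 0) ∧
      ∀ f, ∃ N : ℕ, ∃ j ∈ J, ∃ r, (∀ d ∈ T, coeff d r = 0) ∧ C (c ^ N) * f = j + r := by
  classical
  let o : MonomialOrder (Fin n) := MonomialOrder.lex
  let T : Set (Fin n →₀ ℕ) := {d | ∃ g ∈ J, g ≠ 0 ∧ o.degree g = d}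
  choose! G hGJ hG0 hGd using fun (d : Fin n →₀ ℕ) (hd : d ∈ T) => hd
  have hfin : {d | Minimal (· ∈ T) d}.Finite :=
    WellQuasiOrderedLE.finite_of_isAntichain (setOfPred_minimal_antichain _)
  let c : A := ∏ d ∈ hfin.toFinset, o.leadingCoeff (G d)
  have hc : c ≠ 0 := Finset.prod_ne_zero_iff.mpr fun d hd =>
    o.leadingCoeff_ne_zero_iff.mpr (hG0 d ((hfin.mem_toFinset.mp hd).prop))
  refine ⟨c, hc, T, fun f hf hf0 => ⟨o.degree f, ⟨f, hf, hf0, rfl⟩,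
    o.coeff_degree_ne_zero_iff.mpr hf0⟩, ?_⟩
  set Q : MvPolynomial (Fin n) A → Prop := fun f => ∃ N : ℕ, ∃ j ∈ J, ∃ r,
    (∀ d ∈ T, coeff d r = 0) ∧ C (c ^ N) * f = j + r with hQ
  have hJ : ∀ f ∈ J, Q f := fun f hf => ⟨0, f, hf, 0, fun _ _ => coeff_zero _, by simp⟩
  have hadd : ∀ f g, Q f → Q g → Q (f + g) := by
    rintro f g ⟨N, j, hj, r, hr, e⟩ ⟨M, j', hj', r', hr', e'⟩
    refine ⟨N + M, C (c ^ M) * j + C (c ^ N) * j',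
      J.add_mem (J.mul_mem_left _ hj) (J.mul_mem_left _ hj'), C (c ^ M) * r + C (c ^ N) * r',
      fun d hd => ?_, ?_⟩
    · rw [coeff_add, coeff_C_mul, coeff_C_mul, hr d hd, hr' d hd, mul_zero, mul_zero, add_zero]
    · rw [pow_add, C_mul]
      linear_combination C (c ^ M) * e + C (c ^ N) * e'
  have hmul : ∀ a f, Q f → Q (C a * f) := by
    rintro a f ⟨N, j, hj, r, hr, e⟩
    refine ⟨N, C a * j, J.mul_mem_left _ hj, C a * r, fun d hd => ?_, ?_⟩
    · rw [coeff_C_mul, hr d hd, mul_zero]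
    · linear_combination C a * e
  have hpow : ∀ f, Q (C c * f) → Q f := by
    rintro f ⟨N, j, hj, r, hr, e⟩
    exact ⟨N + 1, j, hj, r, hr, by rw [← e, pow_succ, C_mul, mul_assoc]⟩
  have hsupp : ∀ f : MvPolynomial (Fin n) A, (∀ d ∈ f.support, Q (monomial d 1)) → Q f := by
    intro f hf
    rw [f.as_sum]
    refine Finset.sum_induction _ Q hadd (hJ 0 J.zero_mem) fun d hd => ?_
    have := hmul (coeff d f) _ (hf d hd)
    rwa [C_mul_monomial, mul_one] at this
  have hmon : ∀ d, Q (monomial d 1) := by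
    intro d
    induction h : o.toSyn d using WellFoundedLT.induction generalizing d with
    | _ x ih =>
    subst h
    by_cases hd : d ∈ T
    · obtain ⟨d', hd'd, hd'⟩ := exists_minimal_le_of_wellFoundedLT (· ∈ T) d hd
      obtain ⟨e, he⟩ : o.leadingCoeff (G d') ∣ c :=
        Finset.dvd_prod_of_mem _ (hfin.mem_toFinset.mpr hd')
      apply hpow
      have hsplit : C c * monomial d 1 = monomial (d - d') e * G d' +
          (C c * monomial d 1 - monomial (d - d') e * G d') := by ring
      rw [hsplit]
      refine hadd _ _ (hJ _ (J.mul_mem_left _ (hGJ d' hd'.prop))) (hsupp _ fun x hx => ?_)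
      have hdd : d - d' + d' = d := tsub_add_cancel_of_le hd'd
      refine ih _ (lt_of_le_of_ne ?_ fun hxd => ?_) x rfl
      · rw [C_mul_monomial, mul_one] at hx
        refine (o.le_degree hx).trans ((o.degree_sub_le).trans (sup_le (o.degree_monomial_le _) ?_))
        refine (o.degree_mul_le).trans ?_
        rw [hGd d' hd'.prop, map_add, ← hdd, map_add, add_tsub_cancel_right]
        gcongr
        exact o.degree_monomial_le _
      · obtain rfl := o.toSyn.injective hxd
        rw [mem_support_iff] at hx
        apply hx
        have := coeff_monomial_mul d' (x - d') e (G d')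
        rw [hdd] at this
        rw [coeff_sub, this, C_mul_monomial, mul_one, coeff_monomial, if_pos rfl, sub_eq_zero, he,
          MonomialOrder.leadingCoeff, hGd d' hd'.prop, mul_comm]
    · refine ⟨0, 0, J.zero_mem, monomial d 1, fun x hx => ?_, by simp⟩
      rw [coeff_monomial, if_neg]
      rintro rfl
      exact hd hx
  exact fun f => hsupp f fun d _ => hmon d

section

variable {E : Type} [Field E] [Algebra A E]

theorem exists_mem_of_mul_mem_map_comap (I : Ideal (MvPolynomial (Fin n) E))
    (g : MvPolynomial (Fin n) A) (hg : ∀ h, map (algebraMap A E) g * h ∈ I → h ∈ I) :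
    ∃ c : A, c ≠ 0 ∧ ∀ (L : Type) [Field L] (φ : A →+* L), FracSurjective φ → φ c ≠ 0 →
      ∀ h, map φ g * h ∈ (I.comap (map (algebraMap A E))).map (map φ) →
        h ∈ (I.comap (map (algebraMap A E))).map (map φ) := by
  set I' := I.comap (map (algebraMap A E)) with hI'
  obtain ⟨c, hc, T, hT, hdiv⟩ := exists_pow_mul_eq_add (I' ⊔ Ideal.span {g})
  refine ⟨c, hc, fun L _ φ hφ hφc h hh => ?_⟩
  have hunit : ∀ s x, φ s ≠ 0 → C (φ s) * x ∈ I'.map (map φ) → x ∈ I'.map (map φ) :=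
    fun s x hs hx =>
      ((I'.map (map φ)).unit_mul_mem_iff_mem ((isUnit_iff_ne_zero.mpr hs).map C)).mp hx
  obtain ⟨s, hs, h', hh'⟩ := exists_C_mul_eq_map hφ h
  obtain ⟨t, ht, w, hw, hw'⟩ := exists_C_mul_eq_map_of_mem hφ hh
  have hz : C s * w - C t * (g * h') ∈ (RingHom.ker φ).map C := by
    rw [← ker_map_eq, RingHom.mem_ker]
    simp only [map_sub, map_mul, map_C, ← hh', ← hw']
    ring
  have key : ∃ N : ℕ, ∃ j ∈ I', ∃ b, map φ b = 0 ∧ ∃ r, (∀ d ∈ T, coeff d r = 0) ∧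
      C (c ^ N) * (C s * w - C t * (g * h')) = j + g * b + r := by
    rw [mem_map_C_iff] at hz
    generalize C s * w - C t * (g * h') = z at hz
    rw [z.as_sum]
    refine Finset.sum_induction _ (fun z => ∃ N : ℕ, ∃ j ∈ I', ∃ b, map φ b = 0 ∧
      ∃ r, (∀ d ∈ T, coeff d r = 0) ∧ C (c ^ N) * z = j + g * b + r) ?_ ?_ ?_
    · rintro x y ⟨N, j, hj, b, hb, r, hr, e⟩ ⟨M, j', hj', b', hb', r', hr', e'⟩
      refine ⟨N + M, C (c ^ M) * j + C (c ^ N) * j',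
        I'.add_mem (I'.mul_mem_left _ hj) (I'.mul_mem_left _ hj'),
        C (c ^ M) * b + C (c ^ N) * b', ?_, C (c ^ M) * r + C (c ^ N) * r', fun d hd => ?_, ?_⟩
      · rw [map_add, map_mul (map φ), map_mul (map φ), hb, hb', mul_zero, mul_zero, add_zero]
      · rw [coeff_add, coeff_C_mul, coeff_C_mul, hr d hd, hr' d hd, mul_zero, mul_zero, add_zero]
      · rw [pow_add, C_mul]
        linear_combination C (c ^ M) * e + C (c ^ N) * e'
    · exact ⟨0, 0, I'.zero_mem, 0, map_zero _, 0, fun d _ => coeff_zero d, by simp⟩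
    · intro d _
      obtain ⟨N, j, hj, r, hr, e⟩ := hdiv (monomial d 1)
      obtain ⟨i, hi, b, hb, rfl⟩ := Submodule.mem_sup.mp hj
      obtain ⟨b, rfl⟩ := Ideal.mem_span_singleton'.mp hb
      refine ⟨N, C (coeff d z) * i, I'.mul_mem_left _ hi, C (coeff d z) * b, ?_,
        C (coeff d z) * r, fun x hx => ?_, ?_⟩
      · rw [map_mul, map_C, (hz d : φ (coeff d z) = 0), C_0, zero_mul]
      · rw [coeff_C_mul, hr x hx, mul_zero]
      · have : monomial d (coeff d z) = C (coeff d z) * monomial d 1 := by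
          rw [C_mul_monomial, mul_one]
        rw [this]
        linear_combination C (coeff d z) * e
  obtain ⟨N, j, hj, b, hb, r, hr, e⟩ := key
  have hr0 : r = 0 := by
    by_contra hr0
    have hrJ : r ∈ I' ⊔ Ideal.span {g} := by
      have : r = (C (c ^ N) * C s * w - j) + (-(C (c ^ N) * C t * h') - b) * g := by
        linear_combination -e
      rw [this]
      exact Submodule.add_mem_sup (I'.sub_mem (I'.mul_mem_left _ hw) hj)
        (Ideal.mul_mem_left _ _ (Ideal.mem_span_singleton_self g))
    obtain ⟨d, hd, hd0⟩ := hT r hrJ hr0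
    exact hd0 (hr d hd)
  have hmem : C (c ^ N) * C t * h' + b ∈ I' := by
    rw [hI', Ideal.mem_comap]
    refine hg _ ?_
    rw [← map_mul, ← Ideal.mem_comap, ← hI']
    have : g * (C (c ^ N) * C t * h' + b) = C (c ^ N) * C s * w - j := by
      rw [hr0] at e
      linear_combination -e
    rw [this]
    exact I'.sub_mem (I'.mul_mem_left _ hw) hj
  have hmap := Ideal.mem_map_of_mem (map φ) hmem
  rw [map_add, hb, add_zero, map_mul, map_mul, map_C, map_C, ← hh', mul_assoc] at hmap
  exact hunit s _ hs (hunit t _ ht (hunit (c ^ N) _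
    (by rw [map_pow]; exact pow_ne_zero _ hφc) hmap))

end

end MvPolynomial

section

variable {D S : Type} [CommRing D] [CommRing S] [Algebra D S]

theorem IsLocalization.AtPrime.isPrime_map_of_le {P : Ideal D} [P.IsPrime]
    [IsLocalization.AtPrime S P]
    {p : Ideal D} [p.IsPrime] (hpP : p ≤ P) :
    (p.map (algebraMap D S)).IsPrime :=
  IsLocalization.isPrime_of_isPrime_disjoint P.primeCompl S p inferInstance
    (Set.disjoint_compl_left_iff_subset.mpr hpP)

theorem IsLocalization.AtPrime.comap_map_of_le {P : Ideal D} [P.IsPrime]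
    [IsLocalization.AtPrime S P]
    {p : Ideal D} [p.IsPrime] (hpP : p ≤ P) :
    (p.map (algebraMap D S)).comap (algebraMap D S) = p :=
  IsLocalization.under_map_of_isPrime_disjoint P.primeCompl S inferInstance
    (Set.disjoint_compl_left_iff_subset.mpr hpP)

theorem IsLocalization.AtPrime.comap_le (P : Ideal D) [P.IsPrime]
    [IsLocalization.AtPrime S P]
    (p : Ideal S) [hp : p.IsPrime] :
    p.comap (algebraMap D S) ≤ P :=
  Set.disjoint_compl_left_iff_subset.mp
    ((IsLocalization.isPrime_iff_isPrime_disjoint P.primeCompl S p).mp hp).2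

/-- From a prime of `S ⧸ 𝔟` of large height one finds a prime of `D` far below its contraction. -/
theorem Ideal.exists_height_add_le_of_le_height_quotient (P : Ideal D) [P.IsPrime]
    [IsLocalization.AtPrime S P]
    {𝔟 : Ideal S} (N : ℕ)
    (p : Ideal (S ⧸ 𝔟)) [p.IsPrime] (h : (N : ℕ∞) ≤ p.height) :
    ∃ q : Ideal D, q.IsPrime ∧ 𝔟.comap (algebraMap D S) ≤ q ∧
      q ≤ p.comap ((Ideal.Quotient.mk 𝔟).comp (algebraMap D S)) ∧
      q.height + N ≤ (p.comap ((Ideal.Quotient.mk 𝔟).comp (algebraMap D S))).height := by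
  induction N generalizing p with
  | zero =>
    refine ⟨_, Ideal.comap_isPrime _ p, ?_, le_rfl, by simp⟩
    rw [← Ideal.comap_comap]
    refine Ideal.comap_mono fun x hx => ?_
    simp [Ideal.mem_comap, Ideal.Quotient.eq_zero_iff_mem.mpr hx]
  | succ N ih =>
    obtain ⟨r, hr, hrp, hN⟩ := Ideal.exists_lt_natCast_le_height h
    obtain ⟨q, hq, hbq, hqr, hle⟩ := ih r hN
    refine ⟨q, hq, hbq, hqr.trans (Ideal.comap_mono hrp.le), ?_⟩
    have hlt : r.comap ((Ideal.Quotient.mk 𝔟).comp (algebraMap D S)) <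
        p.comap ((Ideal.Quotient.mk 𝔟).comp (algebraMap D S)) := by
      refine lt_of_le_of_ne (Ideal.comap_mono hrp.le) fun he => hrp.ne ?_
      rw [← Ideal.comap_comap, ← Ideal.comap_comap] at he
      have := congrArg (Ideal.map (algebraMap D S)) he
      exact Ideal.comap_injective_of_surjective _ Ideal.Quotient.mk_surjective
        (((IsLocalization.map_under P.primeCompl S _).symm.trans this).trans
          (IsLocalization.map_under P.primeCompl S _))
    have h1 : (r.comap ((Ideal.Quotient.mk 𝔟).comp (algebraMap D S))).height + 1 ≤
        (p.comap ((Ideal.Quotient.mk 𝔟).comp (algebraMap D S))).height :=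
      Ideal.height_add_one_le_of_lt_of_isPrime hlt
    refine le_trans ?_ h1
    push_cast
    rw [← add_assoc]
    gcongr

theorem Ideal.le_height_quotient_of_le_height_map_mk (P : Ideal D) [P.IsPrime]
    [IsLocalization.AtPrime S P]
    {𝔟 : Ideal S} (N : ℕ)
    {q : Ideal D} [q.IsPrime] (hbq : 𝔟.comap (algebraMap D S) ≤ q)
    (p : Ideal (S ⧸ 𝔟)) [p.IsPrime]
    (hqp : q ≤ p.comap ((Ideal.Quotient.mk 𝔟).comp (algebraMap D S)))
    (h : (N : ℕ∞) ≤ ((p.comap ((Ideal.Quotient.mk 𝔟).comp (algebraMap D S))).map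
      (Ideal.Quotient.mk q)).height) : (N : ℕ∞) ≤ p.height := by
  induction N generalizing p with
  | zero => simp
  | succ N ih =>
    have hp1 : ((p.comap ((Ideal.Quotient.mk 𝔟).comp (algebraMap D S))).map
      (Ideal.Quotient.mk q)).IsPrime := Ideal.isPrime_map_quotientMk_of_isPrime hqp
    obtain ⟨r, hr, hrp, hN⟩ := Ideal.exists_lt_natCast_le_height h
    have hpP : p.comap ((Ideal.Quotient.mk 𝔟).comp (algebraMap D S)) ≤ P := by
      rw [← Ideal.comap_comap]
      exact IsLocalization.AtPrime.comap_le P _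
    have hs := Ideal.Quotient.mk_surjective (I := q)
    have hr0 : (r.comap (Ideal.Quotient.mk q)).IsPrime := inferInstance
    have hqr : q ≤ r.comap (Ideal.Quotient.mk q) := fun x hx => by
      simp [Ideal.mem_comap, Ideal.Quotient.eq_zero_iff_mem.mpr hx]
    have hrp' : r.comap (Ideal.Quotient.mk q) <
        p.comap ((Ideal.Quotient.mk 𝔟).comp (algebraMap D S)) := by
      have h1 : ((p.comap ((Ideal.Quotient.mk 𝔟).comp (algebraMap D S))).map
          (Ideal.Quotient.mk q)).comap (Ideal.Quotient.mk q) =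
          p.comap ((Ideal.Quotient.mk 𝔟).comp (algebraMap D S)) := by
        rw [Ideal.comap_map_of_surjective _ hs, sup_eq_left]
        exact (Ideal.mk_ker (I := q)).le.trans hqp
      rw [← h1]
      refine lt_of_le_of_ne (Ideal.comap_mono hrp.le) fun he => hrp.ne ?_
      exact Ideal.comap_injective_of_surjective _ hs he
    have hmr := Ideal.map_comap_of_surjective _ hs r
    generalize r.comap (Ideal.Quotient.mk q) = r₀ at *
    have hr0P : r₀ ≤ P := hrp'.le.trans hpP
    have hr1 := IsLocalization.AtPrime.isPrime_map_of_le (S := S) hr0P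
    have hbr : 𝔟 ≤ r₀.map (algebraMap D S) := by
      rw [← IsLocalization.map_under P.primeCompl S 𝔟]
      exact Ideal.map_mono (hbq.trans hqr)
    have hr2 : ((r₀.map (algebraMap D S)).map (Ideal.Quotient.mk 𝔟)).IsPrime :=
      Ideal.isPrime_map_quotientMk_of_isPrime hbr
    have hcomap : ((r₀.map (algebraMap D S)).map (Ideal.Quotient.mk 𝔟)).comap
        ((Ideal.Quotient.mk 𝔟).comp (algebraMap D S)) = r₀ := by
      have : ((r₀.map (algebraMap D S)).map (Ideal.Quotient.mk 𝔟)).comap (Ideal.Quotient.mk 𝔟) =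
          r₀.map (algebraMap D S) := by
        rw [Ideal.comap_map_of_surjective _ Ideal.Quotient.mk_surjective, sup_eq_left]
        exact (Ideal.mk_ker (I := 𝔟)).le.trans hbr
      rw [← Ideal.comap_comap, this, IsLocalization.AtPrime.comap_map_of_le hr0P]
    have h2 := ih ((r₀.map (algebraMap D S)).map (Ideal.Quotient.mk 𝔟)) (by rwa [hcomap])
      (by rwa [hcomap, hmr])
    have hlt : (r₀.map (algebraMap D S)).map (Ideal.Quotient.mk 𝔟) < p := by
      refine lt_of_le_of_ne ?_ fun he => ?_
      · rw [Ideal.map_map, Ideal.map_le_iff_le_comap]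
        exact hrp'.le
      · rw [← he, hcomap] at hrp'
        exact lt_irrefl _ hrp'
    have h3 := Ideal.height_add_one_le_of_lt_of_isPrime hlt
    push_cast
    refine le_trans ?_ h3
    gcongr

theorem Ideal.natCast_le_height_map_mk_iff (F : Type) [Field F] (P : Ideal D) [P.IsPrime]
    [IsLocalization.AtPrime S P]
    [Algebra F D] [IsDomain D]
    [Algebra.FiniteType F D] (𝔞 𝔟 : Ideal S) (N : ℕ) (hba : 𝔟 ≤ 𝔞) :
    (N : ℕ∞) ≤ (𝔞.map (Ideal.Quotient.mk 𝔟)).height ↔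
      ∀ p : Ideal D, p.IsPrime → 𝔞.comap (algebraMap D S) ≤ p → p ≤ P →
        ∃ q : Ideal D, q.IsPrime ∧ 𝔟.comap (algebraMap D S) ≤ q ∧ q ≤ p ∧
          q.height + N ≤ p.height := by
  have : IsNoetherianRing D := Algebra.FiniteType.isNoetherianRing F D
  constructor
  · intro h p hp hap hpP
    have hp1 := IsLocalization.AtPrime.isPrime_map_of_le (S := S) hpP
    have hap' : 𝔞 ≤ p.map (algebraMap D S) := by
      rw [← IsLocalization.map_under P.primeCompl S 𝔞]
      exact Ideal.map_mono hap
    have hp2 : ((p.map (algebraMap D S)).map (Ideal.Quotient.mk 𝔟)).IsPrime :=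
      Ideal.isPrime_map_quotientMk_of_isPrime (hba.trans hap')
    have hcomap : ((p.map (algebraMap D S)).map (Ideal.Quotient.mk 𝔟)).comap
        ((Ideal.Quotient.mk 𝔟).comp (algebraMap D S)) = p := by
      have : ((p.map (algebraMap D S)).map (Ideal.Quotient.mk 𝔟)).comap (Ideal.Quotient.mk 𝔟) =
          p.map (algebraMap D S) := by
        rw [Ideal.comap_map_of_surjective _ Ideal.Quotient.mk_surjective, sup_eq_left]
        exact (Ideal.mk_ker (I := 𝔟)).le.trans (hba.trans hap')
      rw [← Ideal.comap_comap, this, IsLocalization.AtPrime.comap_map_of_le hpP]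
    have := Ideal.exists_height_add_le_of_le_height_quotient P N
      ((p.map (algebraMap D S)).map (Ideal.Quotient.mk 𝔟))
      (h.trans (Ideal.height_mono (Ideal.map_mono hap')))
    rwa [hcomap] at this
  · intro h
    rw [Ideal.height_eq_inf_minimalPrimes]
    refine le_iInf₂ fun p hp => ?_
    have hpp : p.IsPrime := hp.isPrime
    obtain ⟨q, hq, hbq, hqp, hle⟩ := h (p.comap ((Ideal.Quotient.mk 𝔟).comp (algebraMap D S)))
      (Ideal.comap_isPrime _ p) (by
        rw [← Ideal.comap_comap]
        exact Ideal.comap_mono (Ideal.map_le_iff_le_comap.mp hp.1.2)) (by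
        rw [← Ideal.comap_comap]
        exact IsLocalization.AtPrime.comap_le P _)
    refine Ideal.le_height_quotient_of_le_height_map_mk P N hbq p hqp ?_
    have hpp' : (p.comap ((Ideal.Quotient.mk 𝔟).comp (algebraMap D S))).IsPrime :=
      Ideal.comap_isPrime _ p
    rw [← Ideal.height_map_mk_add_eq (F := F) hqp, add_comm] at hle
    exact (ENat.add_le_add_iff_right Ideal.height_ne_top_of_isPrime).mp hle

end

theorem Ideal.exists_minimalPrimes_comap_le {B R : Type} [CommRing B] [CommRing R]
    [IsNoetherianRing R] (f : B →+* R) {I : Ideal R} {Q : Ideal B} [hQ : Q.IsPrime]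
    (h : I.comap f ≤ Q) : ∃ p ∈ I.minimalPrimes, p.comap f ≤ Q := by
  have hfin := Ideal.finite_minimalPrimes_of_isNoetherianRing R I
  have h1 : hfin.toFinset.inf (fun p => p.comap f) ≤ Q := by
    intro x hx
    have h2 : f x ∈ I.radical := by
      rw [← Ideal.sInf_minimalPrimes, Ideal.mem_sInf]
      intro p hp
      exact (Finset.inf_le (f := fun p : Ideal R => p.comap f) (hfin.mem_toFinset.mpr hp)) hx
    obtain ⟨N, hN⟩ := h2
    exact hQ.mem_of_pow_mem N (h (by rwa [Ideal.mem_comap, map_pow]))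
  obtain ⟨p, hp, hpQ⟩ := (Ideal.IsPrime.inf_le' hQ).mp h1
  exact ⟨p, hfin.mem_toFinset.mp hp, hpQ⟩

namespace MvPolynomial

variable {A E : Type} [CommRing A] [IsDomain A] [Field E] [Algebra A E] [IsFractionRing A E]
  {n : ℕ}

theorem map_comap_map_algebraMap (I : Ideal (MvPolynomial (Fin n) E)) :
    (I.comap (map (algebraMap A E))).map (map (algebraMap A E)) = I := by
  refine le_antisymm Ideal.map_comap_le fun x hx => ?_
  obtain ⟨s, hs, h, e⟩ := exists_C_mul_eq_map (fracSurjective_algebraMap A E) x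
  rw [← Ideal.unit_mul_mem_iff_mem _ ((isUnit_iff_ne_zero.mpr hs).map C), e]
  refine Ideal.mem_map_of_mem _ ?_
  rw [Ideal.mem_comap, ← e]
  exact I.mul_mem_left _ hx

theorem height_le_of_mem_minimalPrimes_map_comap (F : Type) [Field F] [Algebra F A]
    [Algebra.FiniteType F A] {L : Type} [Field L] {φ : A →+* L} (hφ : FracSurjective φ)
    (q : Ideal (MvPolynomial (Fin n) E)) [q.IsPrime] {Q : Ideal (MvPolynomial (Fin n) L)}
    (hQ : Q ∈ ((q.comap (map (algebraMap A E))).map (map φ)).minimalPrimes) :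
    Q.height ≤ q.height := by
  have : IsNoetherianRing A := Algebra.FiniteType.isNoetherianRing F A
  refine (height_le_of_mem_minimalPrimes_map (F := F) hφ _ hQ).trans ?_
  rw [height_comap_map (fracSurjective_algebraMap A E),
    (RingHom.injective_iff_ker_eq_bot _).mp (IsFractionRing.injective A E), Ideal.height_bot,
    zero_add]

theorem exists_forall_height_add_le_iff (F : Type) [Field F] [Algebra F A]
    [Algebra.FiniteType F A] (𝔞 𝔟 P : Ideal (MvPolynomial (Fin n) E))
    (haP : ∀ p ∈ 𝔞.minimalPrimes, p ≤ P) :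
    ∃ c : A, c ≠ 0 ∧ ∀ (L : Type) [Field L] (φ : A →+* L), FracSurjective φ → φ c ≠ 0 →
      ∀ P' : Ideal (MvPolynomial (Fin n) L), P'.IsPrime →
        (P.comap (map (algebraMap A E))).map (map φ) ≤ P' → ∀ N : ℕ,
        ((∀ p : Ideal (MvPolynomial (Fin n) L), p.IsPrime →
          (𝔞.comap (map (algebraMap A E))).map (map φ) ≤ p → p ≤ P' →
          ∃ q : Ideal (MvPolynomial (Fin n) L), q.IsPrime ∧
            (𝔟.comap (map (algebraMap A E))).map (map φ) ≤ q ∧ q ≤ p ∧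
            q.height + N ≤ p.height) ↔
        ∀ p : Ideal (MvPolynomial (Fin n) E), p.IsPrime → 𝔞 ≤ p → p ≤ P →
          ∃ q : Ideal (MvPolynomial (Fin n) E), q.IsPrime ∧ 𝔟 ≤ q ∧ q ≤ p ∧
            q.height + N ≤ p.height) := by
  classical
  set ι := map (σ := Fin n) (algebraMap A E) with hι
  choose c hc0 hc using exists_height_map_le_of_map_le (E := E) (A := A) (n := n)
  have hfa := Ideal.finite_minimalPrimes_of_isNoetherianRing _ 𝔞
  have hfb := Ideal.finite_minimalPrimes_of_isNoetherianRing _ 𝔟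
  refine ⟨(∏ p ∈ hfa.toFinset, c (p.comap ι)) * (∏ q ∈ hfb.toFinset, c (q.comap ι)) *
    ∏ x ∈ hfa.toFinset ×ˢ hfb.toFinset, c (x.1.comap ι ⊔ x.2.comap ι),
    mul_ne_zero (mul_ne_zero (Finset.prod_ne_zero_iff.mpr fun _ _ => hc0 _)
      (Finset.prod_ne_zero_iff.mpr fun _ _ => hc0 _))
      (Finset.prod_ne_zero_iff.mpr fun _ _ => hc0 _), fun L _ φ hφ hφc P' hP' hPP' N => ?_⟩
  rw [map_mul, map_mul, map_prod, map_prod, map_prod, mul_ne_zero_iff, mul_ne_zero_iff,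
    Finset.prod_ne_zero_iff, Finset.prod_ne_zero_iff, Finset.prod_ne_zero_iff] at hφc
  obtain ⟨⟨hca, hcb⟩, hcab⟩ := hφc
  have hLBa : ∀ p ∈ 𝔞.minimalPrimes, ∀ p' : Ideal (MvPolynomial (Fin n) L), p'.IsPrime →
      (p.comap ι).map (map φ) ≤ p' → p.height ≤ p'.height := fun p hp p' hp' h => by
    have := hc _ L φ (hca p (hfa.mem_toFinset.mpr hp)) p' hp' h
    rwa [map_comap_map_algebraMap] at this
  have hLBb : ∀ p ∈ 𝔟.minimalPrimes, ∀ p' : Ideal (MvPolynomial (Fin n) L), p'.IsPrime →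
      (p.comap ι).map (map φ) ≤ p' → p.height ≤ p'.height := fun p hp p' hp' h => by
    have := hc _ L φ (hcb p (hfb.mem_toFinset.mpr hp)) p' hp' h
    rwa [map_comap_map_algebraMap] at this
  have hLBab : ∀ p ∈ 𝔞.minimalPrimes, ∀ q ∈ 𝔟.minimalPrimes,
      ∀ p' : Ideal (MvPolynomial (Fin n) L), p'.IsPrime → (p.comap ι).map (map φ) ≤ p' →
      (q.comap ι).map (map φ) ≤ p' → (p ⊔ q).height ≤ p'.height :=
      fun p hp q hq p' hp' h h' => by
    have := hc _ L φ (hcab (p, q) (Finset.mem_product.mpr ⟨hfa.mem_toFinset.mpr hp,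
      hfb.mem_toFinset.mpr hq⟩)) p' hp' (by
        rw [Ideal.map_sup]
        exact sup_le h h')
    rwa [Ideal.map_sup, map_comap_map_algebraMap, map_comap_map_algebraMap] at this
  have hmono : ∀ I J : Ideal (MvPolynomial (Fin n) E), I ≤ J →
      (I.comap ι).map (map φ) ≤ (J.comap ι).map (map φ) :=
    fun I J h => Ideal.map_mono (Ideal.comap_mono h)
  have hmin : ∀ (I : Ideal (MvPolynomial (Fin n) E)) (p' : Ideal (MvPolynomial (Fin n) L)),
      p'.IsPrime → (I.comap ι).map (map φ) ≤ p' →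
      ∃ p ∈ I.minimalPrimes, (p.comap ι).map (map φ) ≤ p' := fun I p' hp' h => by
    simp only [Ideal.map_le_iff_le_comap] at h ⊢
    exact Ideal.exists_minimalPrimes_comap_le ι h
  constructor
  · intro H p hp hap hpP
    obtain ⟨p₀, hp₀, hp₀p⟩ := Ideal.exists_minimalPrimes_le hap
    have hp₀p' := hp₀.isPrime
    have := hp₀.isPrime
    obtain ⟨p', hp', hp'P⟩ := Ideal.exists_minimalPrimes_le (J := P')
      (I := (p₀.comap ι).map (map φ))
      ((hmono _ _ (haP p₀ hp₀)).trans hPP')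
    have hht := height_le_of_mem_minimalPrimes_map_comap F hφ p₀ hp'
    obtain ⟨q', hq', hbq', hqp', hN⟩ := H p' hp'.isPrime ((hmono _ _ hp₀.1.2).trans hp'.1.2) hp'P
    obtain ⟨q, hq, hqq'⟩ := hmin _ q' hq' hbq'
    have hqp := hq.isPrime
    have hle : q ≤ p₀ := by
      by_contra hle
      have hlt : p₀ < p₀ ⊔ q := left_lt_sup.mpr hle
      have h1 := hLBab p₀ hp₀ q hq p' hp'.isPrime hp'.1.2 (hqq'.trans hqp')
      have h2 := Ideal.height_strict_mono_of_isPrime hlt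
      exact absurd h2 (not_lt.mpr (h1.trans hht))
    refine ⟨q, hqp, hq.1.2, hle.trans hp₀p, ?_⟩
    calc q.height + N ≤ q'.height + N := by gcongr; exact hLBb q hq q' hq' hqq'
      _ ≤ p'.height := hN
      _ ≤ p₀.height := hht
      _ ≤ p.height := Ideal.height_mono hp₀p
  · intro H p' hp' hap' hpP'
    obtain ⟨p, hp, hpp'⟩ := hmin _ p' hp' hap'
    obtain ⟨q, hq, hbq, hqp, hN⟩ := H p hp.isPrime hp.1.2 (haP p hp)
    obtain ⟨q', hq', hqp'⟩ := Ideal.exists_minimalPrimes_le ((hmono _ _ hqp).trans hpp')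
    refine ⟨q', hq'.isPrime, (hmono _ _ hbq).trans hq'.1.2, hqp', ?_⟩
    calc q'.height + N ≤ q.height + N := by
          gcongr
          exact height_le_of_mem_minimalPrimes_map_comap F hφ q hq'
      _ ≤ p.height := hN
      _ ≤ p'.height := hLBa p hp p' hp' hpp'

/-- Up to one common multiplier outside `P`, the polynomials in the contraction of an ideal of
the local ring at `P` are combinations of the numerators of its generators. -/
theorem exists_mul_mem_span_numerators [IsNoetherianRing A] (P : Ideal (MvPolynomial (Fin n) E))
    [P.IsPrime] {S : Type} [CommRing S] [Algebra (MvPolynomial (Fin n) E) S]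
    [IsLocalization.AtPrime S P] {t : ℕ} (a : Fin t → S) :
    ∃ (f g : Fin t → MvPolynomial (Fin n) A) (h : MvPolynomial (Fin n) A),
      (∀ i, map (algebraMap A E) (g i) ∉ P) ∧
      (∀ i, a i * algebraMap _ S (map (algebraMap A E) (g i)) =
        algebraMap _ S (map (algebraMap A E) (f i))) ∧
      map (algebraMap A E) h ∉ P ∧
      ∀ e, algebraMap _ S (map (algebraMap A E) e) ∈ Ideal.span (Set.range a) →
        h * e ∈ Ideal.span (Set.range f) := by
  classical
  set ι := map (σ := Fin n) (algebraMap A E) with hι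
  have hinj : Function.Injective ι := map_injective _ (IsFractionRing.injective A E)
  have hfrac : ∀ x : S, ∃ f g : MvPolynomial (Fin n) A, ι g ∉ P ∧
      x * algebraMap _ S (ι g) = algebraMap _ S (ι f) := by
    intro x
    obtain ⟨⟨y, z⟩, hyz⟩ := IsLocalization.surj P.primeCompl x
    obtain ⟨s, hs, y', hy⟩ := exists_C_mul_eq_map (fracSurjective_algebraMap A E) y
    obtain ⟨t, ht, z', hz⟩ := exists_C_mul_eq_map (fracSurjective_algebraMap A E) z.1
    have hts : ι (C s * z') ∉ P := by
      have : ι (C s * z') = C (algebraMap A E s) * (C (algebraMap A E t) * z.1) := by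
        rw [map_mul, hz, hι, map_C]
      rw [this]
      intro hmem
      rw [Ideal.unit_mul_mem_iff_mem _ ((isUnit_iff_ne_zero.mpr hs).map C),
        Ideal.unit_mul_mem_iff_mem _ ((isUnit_iff_ne_zero.mpr ht).map C)] at hmem
      exact z.2 hmem
    refine ⟨C t * y', C s * z', hts, ?_⟩
    have h1 : ι (C s * z') = C (algebraMap A E s) * C (algebraMap A E t) * z.1 := by
      rw [map_mul, hι, ← hz, map_C, mul_assoc]
    have h2 : ι (C t * y') = C (algebraMap A E s) * C (algebraMap A E t) * y := by
      rw [map_mul, hι, ← hy, map_C]; ring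
    rw [h1, h2, map_mul _ _ z.1, map_mul _ _ y, ← hyz]
    ring
  choose f g hg hfg using fun i => hfrac (a i)
  have hspan : Ideal.span (Set.range a) =
      ((Ideal.span (Set.range f)).map ι).map (algebraMap _ S) := by
    rw [Ideal.map_span, Ideal.map_span]
    refine le_antisymm (Ideal.span_le.mpr ?_) (Ideal.span_le.mpr ?_)
    · rintro _ ⟨i, rfl⟩
      have hu : IsUnit (algebraMap _ S (ι (g i))) :=
        IsLocalization.map_units S (⟨ι (g i), hg i⟩ : P.primeCompl)
      rw [SetLike.mem_coe, ← Ideal.mul_unit_mem_iff_mem _ hu, hfg]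
      exact Ideal.subset_span ⟨_, ⟨_, ⟨i, rfl⟩, rfl⟩, rfl⟩
    · rintro _ ⟨_, ⟨_, ⟨i, rfl⟩, rfl⟩, rfl⟩
      rw [SetLike.mem_coe, ← hfg]
      exact Ideal.mul_mem_right _ _ (Ideal.subset_span ⟨i, rfl⟩)
  have helem : ∀ e, algebraMap _ S (ι e) ∈ Ideal.span (Set.range a) →
      ∃ h, ι h ∉ P ∧ h * e ∈ Ideal.span (Set.range f) := by
    intro e he
    rw [hspan, IsLocalization.algebraMap_mem_map_algebraMap_iff P.primeCompl] at he
    obtain ⟨m, hm, hme⟩ := he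
    obtain ⟨s, hs, w, hw, e1⟩ := exists_C_mul_eq_map_of_mem (fracSurjective_algebraMap A E) hme
    obtain ⟨t, ht, m', e2⟩ := exists_C_mul_eq_map (fracSurjective_algebraMap A E) m
    have h1 : ι (C s * m') = C (algebraMap A E s) * (C (algebraMap A E t) * m) := by
      rw [map_mul, e2, hι, map_C]
    refine ⟨C s * m', ?_, ?_⟩
    · rw [h1]
      intro hmem
      rw [Ideal.unit_mul_mem_iff_mem _ ((isUnit_iff_ne_zero.mpr hs).map C),
        Ideal.unit_mul_mem_iff_mem _ ((isUnit_iff_ne_zero.mpr ht).map C)] at hmem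
      exact hm hmem
    · have : C s * m' * e = C t * w := hinj (by
        rw [map_mul, h1, map_mul _ _ w, ← e1, hι, map_C]
        ring)
      rw [this]
      exact Ideal.mul_mem_left _ _ hw
  obtain ⟨T, hT⟩ := (isNoetherianRing_iff_ideal_fg _).mp 
    (inferInstance : IsNoetherianRing (MvPolynomial (Fin n) A))
    ((Ideal.span (Set.range a)).comap ((algebraMap _ S).comp ι))
  have hTmem : ∀ e ∈ T, algebraMap _ S (ι e) ∈ Ideal.span (Set.range a) := fun e he => by
    have : e ∈ (Ideal.span (Set.range a)).comap ((algebraMap _ S).comp ι) :=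
      hT ▸ Ideal.subset_span he
    exact this
  choose! h hhP hh using fun e he => helem e (hTmem e he)
  refine ⟨f, g, ∏ e ∈ T, h e, hg, hfg, ?_, fun e he => ?_⟩
  · rw [map_prod, Ideal.IsPrime.prod_mem_iff]
    push Not
    exact hhP
  · have he' : e ∈ Ideal.span (T : Set (MvPolynomial (Fin n) A)) := by
      have : e ∈ (Ideal.span (Set.range a)).comap ((algebraMap _ S).comp ι) := he
      rwa [← hT] at this
    clear he
    induction he' using Submodule.span_induction with
    | mem x hx =>
      rw [← Finset.prod_erase_mul _ _ hx, mul_assoc]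
      exact Ideal.mul_mem_left _ _ (hh x hx)
    | zero => simp
    | add x y _ _ hx hy => rw [mul_add]; exact Ideal.add_mem _ hx hy
    | smul r x _ hx => rw [smul_eq_mul, mul_left_comm]; exact Ideal.mul_mem_left _ _ hx

end MvPolynomial

namespace Spl

open MvPolynomial

variable {k K : Type} [Field k] [Field K] [Algebra k K]

theorem idealHeight_eq {S : Type} [CommRing S] (I : Ideal S) :
    idealHeight I = ((I.height : ℕ∞) : WithBot ℕ∞) := by
  refine le_antisymm ?_ (le_sInf ?_)
  · by_cases hI : I.height = ⊤
    · rw [hI]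
      exact le_top
    · obtain ⟨N, hN⟩ := ENat.ne_top_iff_exists.mp hI
      obtain ⟨p, hp, hIp, hpN⟩ := Ideal.exists_isPrime_height_eq hN.symm
      refine sInf_le ⟨p, hp, hIp, ?_⟩
      rw [← hN, ← hpN]
      exact (IsLocalization.AtPrime.ringKrullDim_eq_height p (Localization p.primeCompl)).symm
  · rintro _ ⟨p, hp, hIp, rfl⟩
    have := IsLocalization.AtPrime.ringKrullDim_eq_height p (Localization p.primeCompl)
    rw [this]
    exact WithBot.coe_le_coe.mpr (Ideal.height_mono hIp)

theorem fracSurjective_evalα {m : ℕ} (α : Fin m → K) : FracSurjective (evalα k K α) := by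
  rintro ⟨x, hx⟩
  obtain ⟨r, s, rfl⟩ := (IntermediateField.mem_adjoin_range_iff k α x).mp hx
  have hval : ∀ p, ((evalα k K α p : kA k K α) : K) = aeval α p := by
    intro p
    change (kA k K α).val (aeval _ p) = _
    rw [comp_aeval_apply]
    rfl
  by_cases hs : aeval α s = 0
  · exact ⟨0, 1, by simp, Subtype.ext (by simp [hs])⟩
  · refine ⟨r, s, fun h => hs ?_, Subtype.ext ?_⟩
    · rw [← hval, h]; rfl
    · rw [MulMemClass.coe_mul, hval, hval]
      exact mul_div_cancel₀ _ hs

theorem coe_evalα {m : ℕ} (α : Fin m → K) (p : MvPolynomial (Fin m) k) :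
    ((evalα k K α p : kA k K α) : K) = eval α (map (algebraMap k K) p) := by
  change (kA k K α).val (aeval _ p) = _
  rw [comp_aeval_apply, eval_map]
  rfl

theorem AlmostAll.of_evalα_ne_zero {m : ℕ} {Q : (Fin m → K) → Prop}
    (c : MvPolynomial (Fin m) k) (hc : c ≠ 0) (h : ∀ α, evalα k K α c ≠ 0 → Q α) :
    AlmostAll K m Q := by
  refine ⟨map (algebraMap k K) c, ?_, fun α hα => h α fun h0 => hα ?_⟩
  · rwa [Ne, ← map_zero (map (algebraMap k K)),
      (map_injective _ (algebraMap k K).injective).eq_iff]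
  · rw [← coe_evalα, h0]; rfl

theorem idealSpec_le_of_isAssociatedPrime {m n : ℕ} {α : Fin m → K} {I : Ideal (Rg k m n)}
    {℘ : Ideal (Ra k K n α)} (h : IsAssociatedPrime ℘ (Ra k K n α ⧸ idealSpec k K n α I)) :
    idealSpec k K n α I ≤ ℘ := by
  obtain ⟨hp, x, rfl⟩ := h
  refine le_trans (fun z hz => ?_) Ideal.le_radical
  obtain ⟨x, rfl⟩ := Ideal.Quotient.mk_surjective x
  rw [Submodule.mem_colon_singleton, Submodule.mem_bot]
  change Ideal.Quotient.mk _ (z * x) = 0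
  rw [Ideal.Quotient.eq_zero_iff_mem]
  exact Ideal.mul_mem_right _ _ hz

theorem notMem_of_isAssociatedPrime {D : Type} [CommRing D] {J ℘ : Ideal D}
    (h : IsAssociatedPrime ℘ (D ⧸ J)) {g : D} (hg : ∀ x, g * x ∈ J → x ∈ J) : g ∉ ℘ := by
  obtain ⟨hp, x, hx⟩ := h
  obtain ⟨x, rfl⟩ := Ideal.Quotient.mk_surjective x
  intro hgp
  rw [hx] at hgp
  obtain ⟨N, hN⟩ := hgp
  rw [Submodule.mem_colon_singleton, Submodule.mem_bot] at hN
  change Ideal.Quotient.mk _ (g ^ N * x) = 0 at hN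
  rw [Ideal.Quotient.eq_zero_iff_mem] at hN
  have hxJ : x ∈ J := by
    induction N with
    | zero => simpa using hN
    | succ N ih =>
      refine ih (hg _ ?_)
      rwa [pow_succ', mul_assoc] at hN
  apply hp.ne_top
  rw [hx, Ideal.eq_top_iff_one]
  refine Ideal.le_radical ?_
  rw [Submodule.mem_colon_singleton, Submodule.mem_bot, one_smul]
  exact Ideal.Quotient.eq_zero_iff_mem.mpr hxJ

theorem toR_injective (m n : ℕ) : Function.Injective (toR k m n) :=
  map_injective _ (IsFractionRing.injective _ _)

theorem isUnit_C {n : ℕ} {L : Type} [Field L] {x : L} (hx : x ≠ 0) :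
    IsUnit (C x : MvPolynomial (Fin n) L) :=
  hx.isUnit.map C

/-- Equality of fractions is preserved by specialization. -/
theorem ElemSpec.mul_toRa_eq {m n : ℕ} {α : Fin m → K} {f g : Rg k m n} {fα gα : Ra k K n α}
    (hf : ElemSpec k K n α f fα) (hg : ElemSpec k K n α g gα)
    {F G : MvPolynomial (Fin n) (MvPolynomial (Fin m) k)}
    (h : f * toR k m n G = g * toR k m n F) :
    fα * toRa k K n α G = gα * toRa k K n α F := by
  obtain ⟨p, q, hq, hqf, hqfα⟩ := hf
  obtain ⟨p', q', hq', hqg, hqgα⟩ := hg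
  have e1 : ∀ q, toR k m n (C q) = C (algebraMap _ (kU k m) q) := fun q => map_C _ q
  have e2 : ∀ q, toRa k K n α (C q) = C (evalα k K α q) := fun q => map_C _ q
  have key : C q' * (p * G) = C q * (p' * F) := by
    apply toR_injective
    rw [map_mul, map_mul, map_mul, map_mul, e1, e1, ← hqf, ← hqg]
    linear_combination (C (algebraMap _ (kU k m) q') * C (algebraMap _ (kU k m) q)) * h
  have key' := congrArg (toRa k K n α) key
  rw [map_mul, map_mul, map_mul, map_mul, e2, e2, ← hqfα, ← hqgα] at key'
  refine ((isUnit_C hq).mul (isUnit_C hq')).mul_left_cancel ?_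
  linear_combination key'

theorem ElemSpec.mem_idealSpec {m n : ℕ} {α : Fin m → K} {f : Rg k m n} {fα : Ra k K n α}
    (hf : ElemSpec k K n α f fα) {I : Ideal (Rg k m n)} (h : f ∈ I) :
    fα ∈ idealSpec k K n α I := by
  obtain ⟨p, q, hq, hqf, hqfα⟩ := hf
  rw [← Ideal.unit_mul_mem_iff_mem _ (isUnit_C hq), hqfα]
  refine Ideal.subset_span ⟨p, ?_, rfl⟩
  change toR k m n p ∈ I
  rw [← hqf]
  exact I.mul_mem_left _ h

theorem idealSpec_mono {m n : ℕ} (α : Fin m → K) {I J : Ideal (Rg k m n)} (h : I ≤ J) :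
    idealSpec k K n α I ≤ idealSpec k K n α J :=
  Ideal.span_mono (Set.image_mono fun _ he => h he)

theorem span_range_eq_map_idealSpec {m n t : ℕ} {α : Fin m → K} {P : Ideal (Rg k m n)} [P.IsPrime]
    {℘ : Ideal (Ra k K n α)} [℘.IsPrime]
    {S : Type} [CommRing S] [Algebra (Rg k m n) S] [IsLocalization.AtPrime S P]
    {Sα : Type} [CommRing Sα] [Algebra (Ra k K n α) Sα] [IsLocalization.AtPrime Sα ℘]
    {a : Fin t → S} {b : Fin t → Sα} (hab : ∀ i, LocElemSpec P ℘ (a i) (b i))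
    {f g : Fin t → MvPolynomial (Fin n) (MvPolynomial (Fin m) k)}
    {h : MvPolynomial (Fin n) (MvPolynomial (Fin m) k)}
    (hfg : ∀ i, a i * algebraMap _ S (toR k m n (g i)) = algebraMap _ S (toR k m n (f i)))
    (hh : ∀ e, algebraMap _ S (toR k m n e) ∈ Ideal.span (Set.range a) →
      h * e ∈ Ideal.span (Set.range f))
    (hh℘ : toRa k K n α h ∉ ℘) :
    Ideal.span (Set.range b) =
      (idealSpec k K n α ((Ideal.span (Set.range a)).comap (algebraMap (Rg k m n) S))).map
        (algebraMap (Ra k K n α) Sα) := by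
  apply le_antisymm
  · rw [Ideal.span_le]
    rintro _ ⟨i, rfl⟩
    obtain ⟨f', g', fα, gα, hg, hgα, hf', hg', ha, hb⟩ := hab i
    rw [SetLike.mem_coe, hb, IsLocalization.mk'_mem_map_algebraMap_iff]
    refine ⟨1, one_mem _, ?_⟩
    rw [one_mul]
    refine hf'.mem_idealSpec ?_
    rw [Ideal.mem_comap, ← IsLocalization.mk'_spec S f' (⟨g', hg⟩ : P.primeCompl), ← ha]
    exact Ideal.mul_mem_right _ _ (Ideal.subset_span ⟨i, rfl⟩)
  · have hF : ∀ i, algebraMap _ Sα (toRa k K n α (f i)) =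
        b i * algebraMap _ Sα (toRa k K n α (g i)) := by
      intro i
      obtain ⟨f', g', fα, gα, hg, hgα, hf', hg', ha, hb⟩ := hab i
      have hinj : Function.Injective (algebraMap (Rg k m n) S) :=
        IsLocalization.injective S P.primeCompl_le_nonZeroDivisors
      have h1 : a i * algebraMap _ S g' = algebraMap _ S f' := by
        rw [ha]
        exact IsLocalization.mk'_spec S f' (⟨g', hg⟩ : P.primeCompl)
      have h2 : f' * toR k m n (g i) = g' * toR k m n (f i) := by
        apply hinj
        rw [map_mul, map_mul, ← h1, ← hfg]
        ring
      have h3 := congrArg (algebraMap _ Sα) (hf'.mul_toRa_eq hg' h2)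
      have h4 : b i * algebraMap _ Sα gα = algebraMap _ Sα fα := by
        rw [hb]
        exact IsLocalization.mk'_spec Sα fα (⟨gα, hgα⟩ : ℘.primeCompl)
      rw [map_mul, map_mul, ← h4] at h3
      refine (IsLocalization.map_units Sα (⟨gα, hgα⟩ : ℘.primeCompl)).mul_left_cancel ?_
      linear_combination -h3
    rw [Ideal.map_le_iff_le_comap, idealSpec, Ideal.span_le]
    rintro _ ⟨e, he, rfl⟩
    rw [SetLike.mem_coe, Ideal.mem_comap]
    refine (Ideal.unit_mul_mem_iff_mem _
      (IsLocalization.map_units Sα (⟨_, hh℘⟩ : ℘.primeCompl))).mp ?_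
    change algebraMap _ Sα (toRa k K n α h) * _ ∈ _
    rw [← map_mul, ← map_mul]
    have h1 := Ideal.mem_map_of_mem ((algebraMap _ Sα).comp (toRa k K n α)) (hh e he)
    refine (Ideal.map_le_iff_le_comap.mpr (Ideal.span_le.mpr ?_)) h1
    rintro _ ⟨i, rfl⟩
    rw [SetLike.mem_coe, Ideal.mem_comap, RingHom.comp_apply, hF]
    exact Ideal.mul_mem_right _ _ (Ideal.subset_span ⟨i, rfl⟩)

/-- A prime of `D` inside `P` contains `J` iff it contains the contraction of the extension of `J`
to the localization at `P`. -/
theorem comap_map_le_iff {D S : Type} [CommRing D] [CommRing S] [Algebra D S] {P : Ideal D}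
    [P.IsPrime] [IsLocalization.AtPrime S P] {J p : Ideal D} [p.IsPrime] (hpP : p ≤ P) :
    (J.map (algebraMap D S)).comap (algebraMap D S) ≤ p ↔ J ≤ p := by
  refine ⟨Ideal.le_comap_map.trans, fun h => ?_⟩
  rw [← IsLocalization.AtPrime.comap_map_of_le (S := S) hpP]
  exact Ideal.comap_mono (Ideal.map_mono h)

/-- for ideals `𝔞 ⊇ 𝔟` of `S`, for almost all `α` one has
`height 𝔞_α/𝔟_α = height 𝔞/𝔟`, i.e. the height of the image of `𝔞_α` in
`S_α/𝔟_α` equals the height of the image of `𝔞` in `S/𝔟` (and `𝔞_α ⊇ 𝔟_α`),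
where `𝔞_α`, `𝔟_α` are generated by specializations of fixed systems of
generators of `𝔞` and `𝔟`. -/
theorem specialization_preserves_height_of_quotient_ideals
    (k K : Type) [Field k] [Field K] [Algebra k K] [Infinite K] {m n : ℕ}
    (P : Ideal (Rg k m n)) [P.IsPrime]
    (S : Type) [CommRing S] [Algebra (Rg k m n) S] [IsLocalization.AtPrime S P]
    (𝔞 𝔟 : Ideal S) (hba : 𝔟 ≤ 𝔞)
    {t t' : ℕ} (a : Fin t → S) (ha : Ideal.span (Set.range a) = 𝔞)
    (c : Fin t' → S) (hc : Ideal.span (Set.range c) = 𝔟) :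
    AlmostAll K m fun α =>
      ∀ (℘ : Ideal (Ra k K n α))
        (h℘ : IsAssociatedPrime ℘ ((Ra k K n α) ⧸ idealSpec k K n α P)),
        haveI := h℘.isPrime
        ∀ (Sα : Type) [CommRing Sα] [Algebra (Ra k K n α) Sα]
          [IsLocalization.AtPrime Sα ℘]
          (b : Fin t → Sα) (d : Fin t' → Sα),
          (∀ i, LocElemSpec P ℘ (a i) (b i)) →
          (∀ i, LocElemSpec P ℘ (c i) (d i)) →
          Ideal.span (Set.range d) ≤ Ideal.span (Set.range b) ∧
          idealHeight ((Ideal.span (Set.range b)).map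
              (Ideal.Quotient.mk (Ideal.span (Set.range d)))) =
            idealHeight (𝔞.map (Ideal.Quotient.mk 𝔟)) := by
  subst ha hc
  set a₀ := (Ideal.span (Set.range a)).comap (algebraMap (Rg k m n) S) with ha₀
  set c₀ := (Ideal.span (Set.range c)).comap (algebraMap (Rg k m n) S) with hc₀
  have haP : ∀ p ∈ a₀.minimalPrimes, p ≤ P := by
    intro p hp
    obtain ⟨q, hq, rfl⟩ := Ideal.exists_minimalPrimes_comap_eq (algebraMap (Rg k m n) S) p hp
    have := hq.1.1
    exact IsLocalization.AtPrime.comap_le P q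
  obtain ⟨c₁, hc₁, H₁⟩ := exists_forall_height_add_le_iff (A := MvPolynomial (Fin m) k)
    (E := kU k m) k a₀ c₀ P haP
  obtain ⟨f, g, h, hg, hfg, hhP, hh⟩ := exists_mul_mem_span_numerators
    (A := MvPolynomial (Fin m) k) P a
  obtain ⟨f', g', h', hg', hfg', hhP', hh'⟩ := exists_mul_mem_span_numerators
    (A := MvPolynomial (Fin m) k) P c
  obtain ⟨c₂, hc₂, H₂⟩ := exists_mem_of_mul_mem_map_comap P h
    fun x hx => (‹P.IsPrime›.mem_or_mem hx).resolve_left hhP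
  obtain ⟨c₃, hc₃, H₃⟩ := exists_mem_of_mul_mem_map_comap P h'
    fun x hx => (‹P.IsPrime›.mem_or_mem hx).resolve_left hhP'
  refine AlmostAll.of_evalα_ne_zero (k := k) (c₁ * c₂ * c₃)
    (mul_ne_zero (mul_ne_zero hc₁ hc₂) hc₃) ?_
  intro α hα ℘ h℘ Sα _ _ _ b d hab hcd
  have := h℘.isPrime
  rw [map_mul, map_mul] at hα
  have hα₁ := left_ne_zero_of_mul (left_ne_zero_of_mul hα)
  have hα₂ := right_ne_zero_of_mul (left_ne_zero_of_mul hα)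
  have hα₃ := right_ne_zero_of_mul hα
  have hφ := fracSurjective_evalα (k := k) α
  have hh℘ : toRa k K n α h ∉ ℘ := notMem_of_isAssociatedPrime h℘ (H₂ _ _ hφ hα₂)
  have hh℘' : toRa k K n α h' ∉ ℘ := notMem_of_isAssociatedPrime h℘ (H₃ _ _ hφ hα₃)
  have hb := span_range_eq_map_idealSpec hab hfg hh hh℘
  have hd := span_range_eq_map_idealSpec hcd hfg' hh' hh℘'
  have hdb : Ideal.span (Set.range d) ≤ Ideal.span (Set.range b) := by
    have hca : c₀ ≤ a₀ := Ideal.comap_mono hba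
    rw [hb, hd]
    exact Ideal.map_mono (idealSpec_mono α hca)
  refine ⟨hdb, ?_⟩
  rw [idealHeight_eq, idealHeight_eq]
  refine congrArg (WithBot.some (α := ℕ∞)) (ENat.eq_of_forall_natCast_le_iff fun N => ?_)
  have e₁ := Ideal.natCast_le_height_map_mk_iff (kA k K α) ℘ (Ideal.span (Set.range b))
    (Ideal.span (Set.range d)) N hdb
  have e₂ := Ideal.natCast_le_height_map_mk_iff (kU k m) P (Ideal.span (Set.range a))
    (Ideal.span (Set.range c)) N hba
  have e₃ := H₁ _ _ hφ hα₁ ℘ h℘.isPrime (idealSpec_le_of_isAssociatedPrime h℘) N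
  refine e₁.trans (Iff.trans ?_ (e₃.trans e₂.symm))
  refine forall₂_congr fun p hp => ?_
  rw [forall_comm, forall_comm (α := _ ≤ p)]
  refine forall_congr' fun hp℘ => ?_
  rw [hb, hd, comap_map_le_iff hp℘]
  refine imp_congr Iff.rfl (exists_congr fun q => ?_)
  refine and_congr_right fun hq => ?_
  rw [and_left_comm, and_left_comm (a := _ ≤ q)]
  refine and_congr_right fun hqp => ?_
  rw [comap_map_le_iff (hqp.trans hp℘)]
  rfl

end Spl
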